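/- arXiv:1111.0582 — 7 statements merged into one kernel-verified Lean document; each statement's English description precedes it below -/
import Mathlib

section
/- Let F be a field, let f_1, …, f_m ∈ F[x_1, …, x_n] be polynomials, and let Φ : F[x_1, …, x_n] → F[z_1, …, z_N] be an F-algebra homomorphism that is faithful to {f_1, …, f_m}, i.e. trdeg_F{f_1, …, f_m} = trdeg_F{Φ(f_1), …, Φ(f_m)}. Then for every polynomial C ∈ F[y_1, …, y_m], the polynomial C(f_1, …, f_m) is zero if and only if C(Φ(f_1), …, Φ(f_m)) is zero. -/
open MvPolynomial

/-- `trdegFam F f` : the maximal cardinality of a subset of the finite family `f`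
that is algebraically independent over `F`. -/
noncomputable def trdegFam (F : Type*) {A : Type*} [CommRing F] [CommRing A] [Algebra F A]
    {m : ℕ} (f : Fin m → A) : ℕ :=
  sSup {k : ℕ | ∃ S : Finset (Fin m), S.card = k ∧
    AlgebraicIndependent F (fun i : {x // x ∈ S} => f i)}

theorem statement0 {F : Type*} [Field F] {n N m : ℕ}
    (f : Fin m → MvPolynomial (Fin n) F)
    (Φ : MvPolynomial (Fin n) F →ₐ[F] MvPolynomial (Fin N) F)
    (hfaithful : trdegFam F f = trdegFam F fun i => Φ (f i))
    (C : MvPolynomial (Fin m) F) :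
    aeval f C = 0 ↔ aeval (fun i => Φ (f i)) C = 0 := by
  have hcomp : ∀ {σ : Type} (g : σ → MvPolynomial (Fin n) F) (D : MvPolynomial σ F),
      aeval (fun i => Φ (g i)) D = Φ (aeval g D) := fun g D =>
    (MvPolynomial.comp_aeval_apply g Φ D).symm
  rw [hcomp]
  refine ⟨fun h => by rw [h, map_zero], fun h => ?_⟩
  have hbdd : BddAbove {k : ℕ | ∃ S : Finset (Fin m), S.card = k ∧
      AlgebraicIndependent F (fun i : {x // x ∈ S} => f i)} := by
    refine ⟨m, ?_⟩
    rintro k ⟨S, rfl, -⟩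
    simpa using S.card_le_univ
  have hmem : trdegFam F (fun i => Φ (f i)) ∈ {k : ℕ | ∃ S : Finset (Fin m), S.card = k ∧
      AlgebraicIndependent F (fun i : {x // x ∈ S} => Φ (f i))} := by
    refine Nat.sSup_mem ⟨0, ∅, rfl, ?_⟩ ⟨m, ?_⟩
    · exact (algebraicIndependent_empty_type_iff).2 (algebraMap F _).injective
    · rintro k ⟨S, rfl, -⟩
      simpa using S.card_le_univ
  obtain ⟨S, hcard, hS⟩ := hmem
  have hSf : AlgebraicIndependent F (fun i : {x // x ∈ S} => f i) :=
    AlgebraicIndependent.of_comp Φ hS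
  have halg : ∀ i, IsAlgebraic (Algebra.adjoin F (f '' (S : Set (Fin m)))) (f i) := by
    intro i
    by_cases hi : i ∈ S
    · exact isAlgebraic_algebraMap
        (⟨f i, Algebra.subset_adjoin ⟨i, hi, rfl⟩⟩ : Algebra.adjoin F (f '' (S : Set (Fin m))))
    · by_contra ht
      have hins := (AlgebraicIndepOn.insert_iff (R := F) (x := f) (s := (S : Set (Fin m)))
        (i := i) (by simpa using hi)).2 ⟨hSf, ht⟩
      have : (insert i S).card ≤ trdegFam F f := by
        refine le_csSup hbdd ⟨insert i S, rfl, ?_⟩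
        rw [← Finset.coe_insert] at hins
        exact hins
      rw [Finset.card_insert_of_notMem hi] at this
      omega
  have hC : IsAlgebraic (Algebra.adjoin F (f '' (S : Set (Fin m)))) (aeval f C) := by
    clear h
    induction C using MvPolynomial.induction_on with
    | C a =>
      rw [aeval_C, IsScalarTower.algebraMap_apply F (Algebra.adjoin F (f '' (S : Set (Fin m))))]
      exact isAlgebraic_algebraMap _
    | add p q hp hq => rw [map_add]; exact hp.add hq
    | mul_X p i hp => rw [map_mul, aeval_X]; exact hp.mul (halg i)
  by_contra hne
  obtain ⟨r, hr, hdvd⟩ := hC.exists_nonzero_dvd (mem_nonZeroDivisors_of_ne_zero hne)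
  obtain ⟨r, hrm⟩ := r
  have h0 : Φ r = 0 := by
    obtain ⟨c, hc⟩ := hdvd
    change r = _ at hc
    rw [hc, map_mul, h, zero_mul]
  have hr' : r ∈ (aeval (R := F) (fun i : {x // x ∈ S} => f i)).range := by
    rw [← Algebra.adjoin_range_eq_range_aeval]
    have hset : Set.range (fun i : {x // x ∈ S} => f i) = f '' (S : Set (Fin m)) := by
      ext y; simp
    rw [hset]
    exact hrm
  obtain ⟨D, rfl⟩ := hr'
  have h1 : aeval (fun i : {x // x ∈ S} => Φ (f i)) D = 0 := by
    rw [hcomp (fun i : {x // x ∈ S} => f i)]; exact h0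
  have := hS.eq_zero_of_aeval_eq_zero D h1
  apply hr
  ext1
  simp [this]
end

section
/- Let F be a field and let f_1, …, f_m ∈ F[x_1, …, x_n] be polynomials of total degree at most d with trdeg_F{f_1, …, f_m} ≤ r. If char(F) = 0 or char(F) > d^r, then trdeg_F{f_1, …, f_m} equals the rank, over the rational function field F(x_1, …, x_n), of the Jacobian matrix 𝒥_x(f_1, …, f_m). -/
open MvPolynomial

section jac
variable {F : Type*} [Field F] {n : ℕ}
variable (L : Type*) [Field L] [Algebra F L] [Algebra (MvPolynomial (Fin n) F) L]
  [IsScalarTower F (MvPolynomial (Fin n) F) L]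

noncomputable def gradD :
    Derivation F (MvPolynomial (Fin n) F) (Fin n → L) :=
  mkDerivation F (fun j => Pi.single j 1)

lemma gradD_apply (a : MvPolynomial (Fin n) F) (j : Fin n) :
    gradD L a j = algebraMap _ L (pderiv j a) := by
  have : ((LinearMap.proj (R := MvPolynomial (Fin n) F) (φ := fun _ : Fin n => L) j).compDer (gradD L)) =
    (Algebra.linearMap (MvPolynomial (Fin n) F) L).compDer (pderiv j) := by
    apply derivation_ext
    intro i
    by_cases h : j = i <;> simp [gradD, pderiv_X, h]
  exact congrArg (fun D => D a) this

lemma der_eq {N : Type*} [AddCommGroup N] [Module F N]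
    [Module (MvPolynomial (Fin n) F) N] [Module L N]
    [IsScalarTower F (MvPolynomial (Fin n) F) N]
    [IsScalarTower (MvPolynomial (Fin n) F) L N]
    (D : Derivation F (MvPolynomial (Fin n) F) N) (a : MvPolynomial (Fin n) F) :
    D a = ∑ j, gradD L a j • D (X j) := by
  have : D = (((Fintype.linearCombination L (fun j => D (X j)) :
      (Fin n → L) →ₗ[_] N).restrictScalars (MvPolynomial (Fin n) F)).compDer (gradD L)) := by
    apply derivation_ext
    intro i
    simp [gradD, Fintype.linearCombination_apply, Pi.single_apply]
  conv_lhs => rw [this]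
  simp [Fintype.linearCombination_apply]

noncomputable abbrev MM {κ : Type*} (g : κ → MvPolynomial (Fin n) F) : IntermediateField F L :=
  IntermediateField.adjoin F (Set.range (algebraMap (MvPolynomial (Fin n) F) L ∘ g))

variable [IsFractionRing (MvPolynomial (Fin n) F) L]

lemma essF {κ : Type*} (g : κ → MvPolynomial (Fin n) F) :
   Algebra.EssFiniteType (MM L g) L := by
  have : Algebra.EssFiniteType (MvPolynomial (Fin n) F) L :=
    Algebra.EssFiniteType.of_isLocalization _ (nonZeroDivisors (MvPolynomial (Fin n) F))
  have : Algebra.EssFiniteType F L :=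
    Algebra.EssFiniteType.comp F (MvPolynomial (Fin n) F) _
  exact Algebra.EssFiniteType.of_comp F _ _

lemma sep_of_span {κ : Type*} (g : κ → MvPolynomial (Fin n) F)
    (h : Submodule.span L (Set.range (gradD L ∘ g)) = ⊤) :
    Algebra.IsSeparable (MM L g) L := by
  have := essF L g
  rw [← Algebra.FormallyUnramified.iff_isSeparable]
  constructor
  let D0 : Derivation (MM L g) L (Ω[L⁄(MM L g)]) := KaehlerDifferential.D _ _
  let D1 : Derivation F L (Ω[L⁄(MM L g)]) := Derivation.mk'
    { toFun := D0, map_add' := D0.map_add, map_smul' := by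
        intro m x
        have h0 : D0 (algebraMap F L m) = 0 := D0.map_algebraMap (algebraMap F (MM L g) m)
        rw [Algebra.smul_def, Derivation.leibniz, h0, smul_zero, add_zero, algebraMap_smul]
        rfl } (by intro a b; simp)
  let D : Derivation F (MvPolynomial (Fin n) F) (Ω[L⁄(MM L g)]) :=
    D1.compAlgebraMap (MvPolynomial (Fin n) F)
  have hDa : ∀ a, D a = D0 (algebraMap _ L a) := fun a => rfl
  let φ := (Fintype.linearCombination L (fun j => D (X j)))
  have hφ : φ = 0 := by
    apply LinearMap.ext_on h
    rintro _ ⟨k, rfl⟩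
    have h1 := der_eq L D (g k)
    simp only [φ, Fintype.linearCombination_apply, Function.comp, LinearMap.zero_apply]
    rw [← h1, hDa]
    exact D0.map_algebraMap (⟨algebraMap _ L (g k), IntermediateField.subset_adjoin _ _ ⟨k, rfl⟩⟩ : MM L g)
  have hD : ∀ a, D0 (algebraMap (MvPolynomial (Fin n) F) L a) = 0 := by
    intro a
    rw [← hDa, der_eq L D a]
    have := congrArg (fun f => f (gradD L a)) hφ
    simpa [φ, Fintype.linearCombination_apply] using this
  have hD0 : ∀ x, D0 x = 0 := by
    intro x
    obtain ⟨a, b, hb, rfl⟩ := IsFractionRing.div_surjective (A := MvPolynomial (Fin n) F) x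
    rw [Derivation.leibniz_div]
    simp [hD]
  rw [← not_nontrivial_iff_subsingleton]
  intro hn
  have := KaehlerDifferential.span_range_derivation (MM L g) L
  have h2 : Set.range (KaehlerDifferential.D (MM L g) L) ⊆ {0} := by
    rintro _ ⟨x, rfl⟩; exact hD0 x
  have h3 := Submodule.span_mono (R := L) h2
  rw [this] at h3
  simp at h3

lemma unit_aux (x : nonZeroDivisors (MvPolynomial (Fin n) F)) :
    IsUnit (algebraMap (MvPolynomial (Fin n) F) (Module.End (MvPolynomial (Fin n) F) L) x) := by
  have hx : algebraMap (MvPolynomial (Fin n) F) L x ≠ 0 :=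
    (IsLocalization.map_units L x).ne_zero
  rw [Module.End.isUnit_iff]
  constructor
  · intro a b hab
    have hab : (x : MvPolynomial (Fin n) F) • a = (x : MvPolynomial (Fin n) F) • b := hab
    rw [Algebra.smul_def, Algebra.smul_def] at hab
    exact mul_left_cancel₀ hx hab
  · intro a
    refine ⟨(algebraMap (MvPolynomial (Fin n) F) L x)⁻¹ * a, ?_⟩
    change (x : MvPolynomial (Fin n) F) • ((algebraMap (MvPolynomial (Fin n) F) L x)⁻¹ * a) = _
    rw [Algebra.smul_def, mul_inv_cancel_left₀ hx]

lemma span_of_sep {κ : Type*} (g : κ → MvPolynomial (Fin n) F)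
    (h : Algebra.IsSeparable (MM L g) L) :
    Submodule.span L (Set.range (gradD L ∘ g)) = ⊤ := by
  by_contra hne
  obtain ⟨φ, hφ0, hφ⟩ := Submodule.exists_le_ker_of_lt_top _ (lt_top_iff_ne_top.2 hne)
  apply hφ0
  let δ : Derivation F (MvPolynomial (Fin n) F) L :=
    (φ.restrictScalars (MvPolynomial (Fin n) F)).compDer (gradD L)
  let ψ : Ω[L⁄F] →ₗ[MvPolynomial (Fin n) F] L :=
    IsLocalizedModule.lift (nonZeroDivisors (MvPolynomial (Fin n) F))
    (KaehlerDifferential.map F F (MvPolynomial (Fin n) F) L) δ.liftKaehlerDifferential (unit_aux L)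
  have hψ : ∀ a : MvPolynomial (Fin n) F,
      ψ (KaehlerDifferential.D F L (algebraMap (MvPolynomial (Fin n) F) L a)) = δ a := by
    intro a
    have := IsLocalizedModule.lift_apply (nonZeroDivisors (MvPolynomial (Fin n) F))
      (KaehlerDifferential.map F F (MvPolynomial (Fin n) F) L) δ.liftKaehlerDifferential
      (unit_aux L) (KaehlerDifferential.D F (MvPolynomial (Fin n) F) a)
    simpa using this
  let ψ' : Ω[L⁄F] →ₗ[L] L := ψ.extendScalarsOfIsLocalization (nonZeroDivisors (MvPolynomial (Fin n) F)) L
  let E : Derivation F L L := ψ'.compDer (KaehlerDifferential.D F L)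
  have hE : ∀ a : MvPolynomial (Fin n) F, E (algebraMap (MvPolynomial (Fin n) F) L a) = φ (gradD L a) := hψ
  have hM : ∀ x ∈ MM L g, E x = 0 := by
    intro x hx
    induction hx using IntermediateField.adjoin_induction with
    | mem x hx =>
      obtain ⟨k, rfl⟩ := hx
      simp only [Function.comp]
      rw [hE]
      exact hφ (Submodule.subset_span ⟨k, rfl⟩)
    | algebraMap x => exact E.map_algebraMap x
    | add x y _ _ hx hy => rw [map_add, hx, hy, add_zero]
    | inv x _ hx => rw [Derivation.leibniz_inv, hx, smul_zero]
    | mul x y _ _ hx hy => rw [Derivation.leibniz, hx, hy, smul_zero, smul_zero, add_zero]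
  have : Algebra.FormallyUnramified (MM L g) L := Algebra.FormallyUnramified.of_isSeparable _ _
  have hs := this.subsingleton_kaehlerDifferential
  let E' : Derivation (MM L g) L L := Derivation.mk'
    { toFun := E, map_add' := E.map_add, map_smul' := by
        intro m x
        have := hM m.1 m.2
        rw [Algebra.smul_def, Derivation.leibniz]
        change _ + _ • E m.1 = _
        rw [this, smul_zero, add_zero]; rfl  } (by intro a b; simp)
  have hE'0 : ∀ x, E x = 0 := by
    intro x
    have h1 : E' x = E'.liftKaehlerDifferential (KaehlerDifferential.D _ _ x) := by simp
    rw [Subsingleton.elim (KaehlerDifferential.D (MM L g) L x) 0, map_zero] at h1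
    exact h1
  refine LinearMap.pi_ext' fun j => LinearMap.ext_ring ?_
  have := hE (X j)
  rw [hE'0] at this
  simp [gradD] at this
  simpa using this.symm

end jac

lemma growth_aux (N : ℕ → ℕ) (n e P C : ℕ) (h0 : 1 ≤ N 0) (hN : ∀ D, N D ≤ (D + 1) ^ n)
    (h : ∀ D, e * N D ≤ P * N (D + C)) : e ≤ P := by
  by_contra hlt
  push Not at hlt
  rcases Nat.eq_zero_or_pos P with rfl | hP
  · have := h 0
    simp at this
    omega
  have h1 : ∀ k, (P + 1) ^ k ≤ P ^ k * N (C * k) := by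
    intro k
    induction k with
    | zero => simpa using h0
    | succ k ih =>
      calc (P + 1) ^ (k + 1) = (P + 1) * (P + 1) ^ k := by ring
        _ ≤ (P + 1) * (P ^ k * N (C * k)) := by gcongr
        _ = P ^ k * ((P + 1) * N (C * k)) := by ring
        _ ≤ P ^ k * (e * N (C * k)) := by gcongr; omega
        _ ≤ P ^ k * (P * N (C * k + C)) := by exact Nat.mul_le_mul_left _ (h _)
        _ = P ^ (k + 1) * N (C * (k + 1)) := by rw [Nat.mul_succ]; ring
  have hr : (1 : ℝ) < (P + 1) / P := by
    rw [lt_div_iff₀ (by positivity)]; linarith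
  have ht := tendsto_pow_const_div_const_pow_of_one_lt n hr
  have hpos : (0 : ℝ) < 1 / (C + 1) ^ n := by positivity
  obtain ⟨k, hk, hk1⟩ := ((ht.eventually_lt_const hpos).and (Filter.eventually_ge_atTop 1)).exists
  have h2 : ((P + 1 : ℕ) : ℝ) ^ k ≤ P ^ k * ((C + 1) ^ n * k ^ n) := by
    have : (P + 1) ^ k ≤ P ^ k * ((C + 1) ^ n * k ^ n) := by
      refine (h1 k).trans ?_
      rw [← mul_pow]
      gcongr
      refine (hN _).trans ?_
      gcongr
      nlinarith
    exact_mod_cast this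
  rw [div_lt_div_iff₀ (by positivity) (by positivity), div_pow, one_mul, lt_div_iff₀ (by positivity)] at hk
  push_cast at h2
  nlinarith

noncomputable def cnt (κ : Type*) [Fintype κ] (w : κ → ℕ) (D : ℕ) : ℕ :=
  Nat.card {a : κ →₀ ℕ // ∑ k, w k * a k ≤ D}

lemma le_of_mem {κ : Type*} [Fintype κ] {w : κ → ℕ} (hw : ∀ k, 1 ≤ w k) {D : ℕ} {a : κ →₀ ℕ}
    (h : ∑ k, w k * a k ≤ D) (k : κ) : a k ≤ D := by
  have h1 : w k * a k ≤ ∑ k, w k * a k :=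
    Finset.single_le_sum (f := fun k => w k * a k) (fun _ _ => Nat.zero_le _) (Finset.mem_univ k)
  nlinarith [hw k]

def bx {κ : Type*} [Fintype κ] {w : κ → ℕ} (hw : ∀ k, 1 ≤ w k) (D : ℕ)
  (a : {a : κ →₀ ℕ // ∑ k, w k * a k ≤ D}) : κ → Fin (D + 1) :=
  fun k => ⟨a.1 k, Nat.lt_succ_of_le (le_of_mem hw a.2 k)⟩

lemma bx_inj {κ : Type*} [Fintype κ] {w : κ → ℕ} (hw : ∀ k, 1 ≤ w k) (D : ℕ) :
    Function.Injective (bx hw D) := by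
  intro a b hab
  ext k
  have := congrFun hab k
  simpa [bx] using this

lemma cnt_fin {κ : Type*} [Fintype κ] {w : κ → ℕ} (hw : ∀ k, 1 ≤ w k) (D : ℕ) :
    Finite {a : κ →₀ ℕ // ∑ k, w k * a k ≤ D} :=
  Finite.of_injective _ (bx_inj hw D)

lemma cnt_le {κ : Type*} [Fintype κ] {w : κ → ℕ} (hw : ∀ k, 1 ≤ w k) (D : ℕ) :
    cnt κ w D ≤ (D + 1) ^ (Fintype.card κ) := by
  classical
  have := Nat.card_le_card_of_injective _ (bx_inj hw D)
  simpa [cnt] using this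

lemma cnt_one_le {κ : Type*} [Fintype κ] {w : κ → ℕ} (hw : ∀ k, 1 ≤ w k) (D : ℕ) :
    cnt κ 1 D ≤ (∏ k, w k) * cnt κ w D := by
  classical
  have := cnt_fin hw D
  let φ : {a : κ →₀ ℕ // ∑ k, (1 : κ → ℕ) k * a k ≤ D} →
      (∀ k, Fin (w k)) × {a : κ →₀ ℕ // ∑ k, w k * a k ≤ D} := fun a =>
    (fun k => ⟨a.1 k % w k, Nat.mod_lt _ (hw k)⟩,
      ⟨Finsupp.equivFunOnFinite.symm (fun k => a.1 k / w k), by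
        refine le_trans ?_ a.2
        apply Finset.sum_le_sum
        intro k _
        simpa using Nat.mul_div_le (a.1 k) (w k)⟩)
  have hφ : Function.Injective φ := by
    intro a b hab
    ext k
    have h1 := congrFun (congrArg Prod.fst hab) k
    have h2 := DFunLike.congr_fun (congrArg Subtype.val (congrArg Prod.snd hab)) k
    simp [φ] at h1 h2
    rw [← Nat.mod_add_div (a.1 k) (w k), h1, h2, Nat.mod_add_div]
  have := Nat.card_le_card_of_injective φ hφ
  simpa [cnt, Nat.card_prod, Nat.card_pi] using this

lemma cnt_congr {κ κ' : Type*} [Fintype κ] [Fintype κ'] (e : κ ≃ κ') (D : ℕ) :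
    cnt κ 1 D = cnt κ' 1 D := by
  refine Nat.card_congr ((Finsupp.domCongr e).toEquiv.subtypeEquiv ?_)
  intro a
  simp [Finsupp.equivMapDomain]
  rw [Equiv.sum_comp e.symm]

lemma finrank_restrict (F : Type*) [Field F] (n D : ℕ) :
    Module.finrank F (restrictTotalDegree (Fin n) F D) = cnt (Fin n) 1 D := by
  refine (Module.finrank_eq_nat_card_basis (basisRestrictSupport F _)).trans ?_
  refine Nat.card_congr (Equiv.subtypeEquivRight ?_)
  intro a
  simp [Finsupp.sum_fintype]

section jac
variable {F : Type*} [Field F] {n : ℕ}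
variable (L : Type*) [Field L] [Algebra F L] [Algebra (MvPolynomial (Fin n) F) L]
  [IsScalarTower F (MvPolynomial (Fin n) F) L]

variable [IsFractionRing (MvPolynomial (Fin n) F) L]

lemma exists_nums {κ : Type*} (g : κ → MvPolynomial (Fin n) F)
    (hfin : Module.Finite (MM L g) L) :
    ∃ c : Fin (Module.finrank (MM L g) L) → MvPolynomial (Fin n) F,
      LinearIndependent (MM L g) (fun i => algebraMap (MvPolynomial (Fin n) F) L (c i)) := by
  obtain ⟨q, hq⟩ := IsLocalization.exist_integer_multiples_of_finite
    (nonZeroDivisors (MvPolynomial (Fin n) F)) (Module.finBasis (MM L g) L)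
  choose c hc using hq
  have hq0 : algebraMap (MvPolynomial (Fin n) F) L q ≠ 0 :=
    (IsLocalization.map_units L q).ne_zero
  refine ⟨c, ?_⟩
  have h1 := (Module.finBasis (MM L g) L).linearIndependent.map'
      (LinearMap.mulLeft (MM L g) (algebraMap (MvPolynomial (Fin n) F) L q))
      (LinearMap.ker_eq_bot.2 (mul_right_injective₀ hq0))
  have h2 : (fun i => algebraMap (MvPolynomial (Fin n) F) L (c i)) =
      (LinearMap.mulLeft (MM L g) (algebraMap (MvPolynomial (Fin n) F) L q)) ∘
        (Module.finBasis (MM L g) L) := by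
    funext i
    rw [hc, Algebra.smul_def]; rfl
  rw [h2]; exact h1

lemma mon_mem {κ : Type*} (g : κ → MvPolynomial (Fin n) F) (a : κ →₀ ℕ) :
    algebraMap (MvPolynomial (Fin n) F) L (aeval g (monomial a (1 : F))) ∈ MM L g := by
  rw [aeval_monomial, map_one, one_mul, Finsupp.prod, map_prod]
  refine prod_mem fun k _ => ?_
  rw [map_pow]
  exact pow_mem (IntermediateField.subset_adjoin F _ (Set.mem_range_self k)) _

lemma prod_indep {κ ι : Type*} (g : κ → MvPolynomial (Fin n) F)
    (hg : AlgebraicIndependent F g) (c : ι → MvPolynomial (Fin n) F)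
    (hc : LinearIndependent (MM L g) (fun i => algebraMap (MvPolynomial (Fin n) F) L (c i))) :
    LinearIndependent F (fun p : (κ →₀ ℕ) × ι =>
      aeval g (monomial p.1 (1 : F)) * c p.2) := by
  let mon : (κ →₀ ℕ) → MM L g := fun a =>
    ⟨algebraMap (MvPolynomial (Fin n) F) L (aeval g (monomial a (1 : F))), mon_mem L g a⟩
  have hinj : Function.Injective (algebraMap (MvPolynomial (Fin n) F) L) :=
    IsFractionRing.injective _ _
  have hmon : LinearIndependent F mon := by
    apply LinearIndependent.of_comp (IntermediateField.val (MM L g)).toLinearMap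
    have h1 := ((basisMonomials κ F).linearIndependent.map' (aeval g).toLinearMap
      (LinearMap.ker_eq_bot.2 hg)).map' (IsScalarTower.toAlgHom F (MvPolynomial (Fin n) F) L).toLinearMap
      (LinearMap.ker_eq_bot.2 hinj)
    have h2 : (IntermediateField.val (MM L g)).toLinearMap ∘ mon =
      (IsScalarTower.toAlgHom F (MvPolynomial (Fin n) F) L).toLinearMap ∘ (aeval g).toLinearMap ∘
        (basisMonomials κ F) := by
      funext a
      simp [mon]
    rw [h2]; exact h1
  have hprod := linearIndependent_smul hmon hc
  apply LinearIndependent.of_comp (IsScalarTower.toAlgHom F (MvPolynomial (Fin n) F) L).toLinearMap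
  have h2 : (IsScalarTower.toAlgHom F (MvPolynomial (Fin n) F) L).toLinearMap ∘
      (fun p : (κ →₀ ℕ) × ι => aeval g (monomial p.1 (1 : F)) * c p.2) =
      fun p => mon p.1 • algebraMap (MvPolynomial (Fin n) F) L (c p.2) := by
    funext p
    exact map_mul (algebraMap (MvPolynomial (Fin n) F) L) _ _
  rw [h2]; exact hprod

lemma key_count {κ : Type*} [Fintype κ] {e C : ℕ} (g : κ → MvPolynomial (Fin n) F)
    (c : Fin e → MvPolynomial (Fin n) F)
    (hli : LinearIndependent F (fun p : (κ →₀ ℕ) × Fin e =>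
      aeval g (monomial p.1 (1 : F)) * c p.2))
    (w : κ → ℕ) (hw : ∀ k, 1 ≤ w k) (hd : ∀ k, (g k).totalDegree ≤ w k)
    (hC : ∀ i, (c i).totalDegree ≤ C) (D : ℕ) : e * cnt κ w D ≤ cnt (Fin n) 1 (D + C) := by
  have := cnt_fin hw D
  have := Fintype.ofFinite {a : κ →₀ ℕ // ∑ k, w k * a k ≤ D}
  have hmem : ∀ p : {a : κ →₀ ℕ // ∑ k, w k * a k ≤ D} × Fin e,
      aeval g (monomial p.1.1 (1 : F)) * c p.2 ∈ restrictTotalDegree (Fin n) F (D + C) := by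
    intro p
    rw [mem_restrictTotalDegree]
    refine (totalDegree_mul _ _).trans (add_le_add ?_ (hC _))
    refine le_trans ?_ p.1.2
    rw [aeval_monomial, map_one, one_mul, Finsupp.prod_fintype _ _ (by simp)]
    refine (totalDegree_finsetProd _ _).trans (Finset.sum_le_sum fun k _ => ?_)
    refine (totalDegree_pow _ _).trans ?_
    rw [mul_comm]
    exact Nat.mul_le_mul_right _ (hd k)
  have hli : LinearIndependent F (fun p : {a : κ →₀ ℕ // ∑ k, w k * a k ≤ D} × Fin e =>
      (⟨_, hmem p⟩ : restrictTotalDegree (Fin n) F (D + C))) := by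
    apply LinearIndependent.of_comp (Submodule.subtype _)
    exact hli.comp (fun p : {a : κ →₀ ℕ // ∑ k, w k * a k ≤ D} × Fin e => (p.1.1, p.2)) (by
      intro p p' h
      have h1 : (p.1.1, p.2) = (p'.1.1, p'.2) := h
      have h2 := Prod.mk.inj h1
      exact Prod.ext (Subtype.ext h2.1) h2.2)
  have h1 := hli.fintype_card_le_finrank
  rw [finrank_restrict] at h1
  rw [Fintype.card_prod, Fintype.card_fin, mul_comm, ← Nat.card_eq_fintype_card] at h1
  exact h1

lemma count_bound {κ : Type*} [Fintype κ] (g : κ → MvPolynomial (Fin n) F)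
    (hg : AlgebraicIndependent F g)
    (w : κ → ℕ) (hw : ∀ k, 1 ≤ w k) (hd : ∀ k, (g k).totalDegree ≤ w k)
    (hcard : Fintype.card κ = n) (hfin : Module.Finite (MM L g) L) :
    Module.finrank (MM L g) L ≤ ∏ k, w k := by
  obtain ⟨c, hc⟩ := exists_nums L g hfin
  generalize Module.finrank (MM L g) L = e at c hc ⊢
  let C := Finset.univ.sup (fun i => (c i).totalDegree)
  have hC : ∀ i, (c i).totalDegree ≤ C := fun i => Finset.le_sup (f := fun i => (c i).totalDegree) (Finset.mem_univ i)
  have key := key_count g c (prod_indep L g hg c hc) w hw hd hC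
  have eqv : κ ≃ Fin n := Fintype.equivFinOfCardEq hcard
  refine growth_aux (cnt κ 1) n e _ C ?_ ?_ ?_
  · have := cnt_fin (κ := κ) (w := 1) (by simp) 0
    have : Nonempty {a : κ →₀ ℕ // ∑ k, (1 : κ → ℕ) k * a k ≤ 0} := ⟨⟨0, by simp⟩⟩
    exact Nat.card_pos
  · intro D
    have := cnt_le (κ := κ) (w := 1) (by simp) D
    rwa [hcard] at this
  · intro D
    calc e * cnt κ 1 D ≤ e * ((∏ k, w k) * cnt κ w D) := by gcongr; exact cnt_one_le hw D
      _ = (∏ k, w k) * (e * cnt κ w D) := by ring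
      _ ≤ (∏ k, w k) * cnt κ 1 (D + C) := by
        gcongr; rw [cnt_congr eqv]; exact key D
end jac

lemma sep_deg (K L : Type*) [Field K] [Field L] [Algebra K L] [Module.Finite K L]
    (h : ringChar K = 0 ∨ Module.finrank K L < ringChar K) : Algebra.IsSeparable K L := by
  rcases h with h | h
  · have : CharP K 0 := by rw [← h]; infer_instance
    have : CharZero K := CharP.charP_to_charZero K
    infer_instance
  · refine ⟨fun x => ?_⟩
    have hx : IsIntegral K x := Algebra.IsIntegral.isIntegral x
    rcases Polynomial.separable_or (ringChar K) (minpoly.irreducible hx) with h1 | ⟨-, g, hg, h2⟩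
    · exact h1
    · exfalso
      have h3 := minpoly.natDegree_le (A := K) x
      have h4 := minpoly.natDegree_pos hx
      rw [← h2, Polynomial.natDegree_expand] at h3 h4
      have : 0 < g.natDegree := Nat.pos_of_mul_pos_right h4
      nlinarith

section jac
variable {F : Type*} [Field F] {n : ℕ}
variable (L : Type*) [Field L] [Algebra F L] [Algebra (MvPolynomial (Fin n) F) L]
  [IsScalarTower F (MvPolynomial (Fin n) F) L]
  [IsFractionRing (MvPolynomial (Fin n) F) L]

lemma algAL : Algebra.IsAlgebraic (MvPolynomial (Fin n) F) L :=
  IsLocalization.isAlgebraic L (nonZeroDivisors (MvPolynomial (Fin n) F))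

lemma fin_of_tb {κ : Type*} (g : κ → MvPolynomial (Fin n) F)
    (hg : IsTranscendenceBasis F g) : Module.Finite (MM L g) L := by
  have := algAL (F := F) (n := n) L
  have h1 : IsTranscendenceBasis F (algebraMap (MvPolynomial (Fin n) F) L ∘ g) :=
    hg.algebraMap_comp
  have h2 : Algebra.IsAlgebraic (MM L g) L := h1.isAlgebraic_field
  have := essF L g
  obtain ⟨s, hs⟩ := IntermediateField.fg_top (MM L g) L
  have h3 : FiniteDimensional (MM L g) (IntermediateField.adjoin (MM L g) (s : Set L)) :=
    IntermediateField.finiteDimensional_adjoin (fun x _ => Algebra.IsIntegral.isIntegral x)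
  rw [hs] at h3
  exact Module.Finite.equiv (IntermediateField.topEquiv (F := MM L g) (E := L)).toLinearEquiv

lemma pos_deg {κ : Type*} (g : κ → MvPolynomial (Fin n) F)
    (hg : AlgebraicIndependent F g) (k : κ) : 1 ≤ (g k).totalDegree := by
  by_contra h
  have h0 : (g k).totalDegree = 0 := by omega
  rw [totalDegree_eq_zero_iff_eq_C] at h0
  have := hg.transcendental k
  rw [h0] at this
  exact this (isAlgebraic_algebraMap _)

lemma ringChar_MM {κ : Type*} (g : κ → MvPolynomial (Fin n) F) :
    ringChar (MM L g) = ringChar F := by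
  have : CharP (MM L g) (ringChar F) :=
    charP_of_injective_algebraMap (algebraMap F (MM L g)).injective (ringChar F)
  exact ringChar.eq (MM L g) (ringChar F)

lemma indep_of_tb {κ : Type*} [Fintype κ] (g : κ → MvPolynomial (Fin n) F)
    (hg : IsTranscendenceBasis F g)
    (hc : ringChar F = 0 ∨ ∏ k, (g k).totalDegree < ringChar F) :
    LinearIndependent L (gradD L ∘ g) := by
  have hfin := fin_of_tb L g hg
  have hcard : Fintype.card κ = n := by
    have := hg.lift_cardinalMk_eq (IsTranscendenceBasis.mvPolynomial (Fin n) F)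
    simpa using this
  have hb := count_bound L g hg.1 (fun k => (g k).totalDegree) (pos_deg g hg.1) (fun _ => le_rfl)
    hcard hfin
  have hs : Algebra.IsSeparable (MM L g) L := by
    apply sep_deg
    rw [ringChar_MM]
    exact hc.imp_right (fun h => hb.trans_lt h)
  have ht := span_of_sep L g hs
  exact linearIndependent_of_top_le_span_of_card_eq_finrank ht.ge (by simp [hcard])

lemma indep_forward {m d r : ℕ} (f : Fin m → MvPolynomial (Fin n) F)
    (hdeg : ∀ i, (f i).totalDegree ≤ d) (S : Finset (Fin m)) (hS : S.card ≤ r)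
    (hind : AlgebraicIndependent F (fun i : {x // x ∈ S} => f i))
    (hchar : ringChar F = 0 ∨ d ^ r < ringChar F) :
    LinearIndependent L (fun i : {x // x ∈ S} => gradD L (f i)) := by
  classical
  let T : Set (MvPolynomial (Fin n) F) := Set.range (fun i : {x // x ∈ S} => f i)
  let U : Set (MvPolynomial (Fin n) F) := T ∪ Set.range X
  have halg : Algebra.IsAlgebraic (Algebra.adjoin F U) (MvPolynomial (Fin n) F) := by
    have : Algebra.adjoin F U = ⊤ := by
      rw [eq_top_iff, ← adjoin_range_X]
      exact Algebra.adjoin_mono Set.subset_union_right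
    rw [this, ← adjoin_range_X]
    exact (IsTranscendenceBasis.mvPolynomial (Fin n) F).isAlgebraic
  obtain ⟨u, hTu, huU, hu⟩ := exists_isTranscendenceBasis_between (R := F) T U
    Set.subset_union_left hind.to_subtype_range
  have hTfin : T.Finite := Set.finite_range _
  have hUfin : U.Finite := hTfin.union (Set.finite_range _)
  have : Fintype u := (hUfin.subset huU).fintype
  have hprod : ringChar F = 0 ∨ ∏ k : u, (k : MvPolynomial (Fin n) F).totalDegree < ringChar F := by
    rcases hchar with h | h
    · exact Or.inl h
    right
    have hp : 1 < ringChar F := by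
      rcases CharP.char_is_prime_or_zero F (ringChar F) with h1 | h1
      · exact h1.one_lt
      · omega
    have hle : ∏ k : u, (k : MvPolynomial (Fin n) F).totalDegree ≤
        ∏ k : u, (if (k : MvPolynomial (Fin n) F) ∈ T then d else 1) := by
      refine Finset.prod_le_prod' fun k _ => ?_
      split_ifs with hk
      · obtain ⟨i, hi⟩ := hk
        rw [← hi]; exact hdeg _
      · rcases huU k.2 with h1 | ⟨j, hj⟩
        · exact absurd h1 hk
        · rw [← hj]; simp
    refine hle.trans_lt ?_
    rw [Finset.prod_ite, Finset.prod_const, Finset.prod_const_one, mul_one]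
    set Q := Finset.univ.filter (fun k : u => (k : MvPolynomial (Fin n) F) ∈ T) with hQ
    have hQc : Q.card ≤ r := by
      refine le_trans ?_ hS
      have : Q.image Subtype.val ⊆ S.image f := by
        intro a ha
        simp only [hQ, Finset.mem_image, Finset.mem_filter] at ha ⊢
        obtain ⟨k, ⟨-, i, hi⟩, rfl⟩ := ha
        exact ⟨i, i.2, hi⟩
      have h2 := Finset.card_le_card this
      rw [Finset.card_image_of_injective _ Subtype.val_injective] at h2
      exact h2.trans Finset.card_image_le
    rcases Q.eq_empty_or_nonempty with h0 | ⟨k, hk⟩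
    · rw [h0]; simpa using hp
    · have hd : 1 ≤ d := by
        simp only [hQ, Finset.mem_filter] at hk
        obtain ⟨-, i, hi⟩ := hk
        exact (pos_deg _ hind i).trans (hdeg _)
      exact (Nat.pow_le_pow_right hd hQc).trans_lt h
  have hli := indep_of_tb L (Subtype.val : u → MvPolynomial (Fin n) F) hu hprod
  have := hli.comp (fun i : {x // x ∈ S} => (⟨f i, hTu ⟨i, rfl⟩⟩ : u)) (by
    intro i j hij
    exact hind.injective (congrArg Subtype.val hij))
  exact this

lemma indep_backward {m : ℕ} (f : Fin m → MvPolynomial (Fin n) F) (S : Set (Fin m))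
    (hS : LinearIndepOn L (fun i => gradD L (f i)) S) :
    AlgebraicIndependent F (fun i : S => f i) := by
  classical
  let h : Fin m ⊕ Fin n → MvPolynomial (Fin n) F := Sum.elim f X
  have h0 : LinearIndepOn L (fun i => gradD L (h i)) (Sum.inl '' S) := by
    have : LinearIndepOn L ((fun i => gradD L (h i)) ∘ Sum.inl) S := hS
    exact this.image_of_comp _ _ 
  obtain ⟨b, -, hSb, hsp, hb⟩ := exists_linearIndepOn_extension h0 (Set.subset_univ _)
  have hspan : Submodule.span L ((fun i => gradD L (h i)) '' b) = ⊤ := by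
    rw [eq_top_iff, ← (Pi.basisFun L (Fin n)).span_eq, Submodule.span_le]
    rintro _ ⟨j, rfl⟩
    apply hsp
    refine ⟨Sum.inr j, trivial, ?_⟩
    simp [h, gradD]
  let g : b → MvPolynomial (Fin n) F := fun i => h i
  have hspan2 : Submodule.span L (Set.range (gradD L ∘ g)) = ⊤ := by
    rw [← hspan, Set.image_eq_range]; rfl
  have hcard : Fintype.card b = n := by
    have := finrank_span_eq_card (R := L) (b := gradD L ∘ g) hb
    rw [hspan2] at this
    simpa using this.symm
  have hsep := sep_of_span L g hspan2
  have halg : Algebra.IsAlgebraic (MM L g) L := inferInstance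
  rw [IntermediateField.isAlgebraic_adjoin_iff_top] at halg
  have := algAL (F := F) (n := n) L
  have htb : IsTranscendenceBasis F (algebraMap (MvPolynomial (Fin n) F) L ∘ X) :=
    (IsTranscendenceBasis.mvPolynomial (Fin n) F).algebraMap_comp
  have htr := htb.lift_cardinalMk_eq_trdeg
  have hT : IsTranscendenceBasis F (algebraMap (MvPolynomial (Fin n) F) L ∘ g) := by
    apply Algebra.IsAlgebraic.isTranscendenceBasis_of_lift_le_trdeg_of_finite
    simp [hcard] at htr ⊢
    simp [← htr]
  have hg : AlgebraicIndependent F g :=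
    AlgebraicIndependent.of_comp (IsScalarTower.toAlgHom F (MvPolynomial (Fin n) F) L) hT.1
  exact hg.comp (fun i : S => (⟨Sum.inl i.1, hSb ⟨i, i.2, rfl⟩⟩ : b)) (by
    intro i j hij
    exact Subtype.ext (Sum.inl.inj (congrArg Subtype.val hij)))
end jac

theorem statement1 {F : Type*} [Field F] {n m d r : ℕ}
    (f : Fin m → MvPolynomial (Fin n) F)
    (hdeg : ∀ i, (f i).totalDegree ≤ d)
    (htd : trdegFam F f ≤ r)
    (hchar : ringChar F = 0 ∨ d ^ r < ringChar F) :
    trdegFam F f =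
      (Matrix.of fun (i : Fin m) (j : Fin n) =>
        algebraMap (MvPolynomial (Fin n) F) (FractionRing (MvPolynomial (Fin n) F))
          (pderiv j (f i))).rank := by
  classical
  set L := FractionRing (MvPolynomial (Fin n) F) with hL
  have hrank : (Matrix.of fun (i : Fin m) (j : Fin n) =>
        algebraMap (MvPolynomial (Fin n) F) L (pderiv j (f i))).rank =
      Module.finrank L (Submodule.span L (Set.range (fun i => gradD L (f i)))) := by
    rw [Matrix.rank_eq_finrank_span_row]
    have : (Matrix.of fun (i : Fin m) (j : Fin n) =>
        algebraMap (MvPolynomial (Fin n) F) L (pderiv j (f i))).row =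
        fun i => gradD L (f i) := by
      funext i j
      rw [gradD_apply]
      rfl
    rw [this]
  rw [hrank]
  have hbdd : BddAbove {k : ℕ | ∃ S : Finset (Fin m), S.card = k ∧
      AlgebraicIndependent F (fun i : {x // x ∈ S} => f i)} := by
    refine ⟨Fintype.card (Fin m), ?_⟩
    rintro k ⟨S, rfl, -⟩
    exact Finset.card_le_univ S
  have hne : {k : ℕ | ∃ S : Finset (Fin m), S.card = k ∧
      AlgebraicIndependent F (fun i : {x // x ∈ S} => f i)}.Nonempty := by
    refine ⟨0, ∅, rfl, ?_⟩
    have : IsEmpty {x // x ∈ (∅ : Finset (Fin m))} := ⟨fun x => absurd x.2 (Finset.notMem_empty x.1)⟩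
    rw [algebraicIndependent_empty_type_iff]
    exact (algebraMap F (MvPolynomial (Fin n) F)).injective
  apply le_antisymm
  · obtain ⟨S, hScard, hSind⟩ := Nat.sSup_mem hne hbdd
    have hScard : S.card = trdegFam F f := hScard
    have hli := indep_forward L f hdeg S (hScard.le.trans htd) hSind hchar
    have h1 := finrank_span_eq_card hli
    rw [Fintype.card_coe, hScard] at h1
    rw [← h1]
    apply Submodule.finrank_mono
    apply Submodule.span_mono
    rintro _ ⟨i, rfl⟩
    exact ⟨i, rfl⟩
  · obtain ⟨b, -, -, hsp, hb⟩ := exists_linearIndepOn_extension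
      (linearIndepOn_empty L (fun i => gradD L (f i))) (Set.subset_univ _)
    have hA := indep_backward L f b hb
    have h1 := finrank_span_eq_card (R := L) (b := fun i : b => gradD L (f i)) hb
    have h2 : Submodule.span L (Set.range (fun i => gradD L (f i))) ≤
        Submodule.span L (Set.range (fun i : b => gradD L (f i))) := by
      rw [Submodule.span_le]
      rintro _ ⟨i, rfl⟩
      have := hsp ⟨i, trivial, rfl⟩
      rwa [Set.image_eq_range] at this
    refine (Submodule.finrank_mono h2).trans ?_
    rw [h1]
    apply le_csSup hbdd
    refine ⟨b.toFinset, by simp [Set.toFinset_card], ?_⟩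
    exact hA.comp (fun i : {x // x ∈ b.toFinset} => (⟨i.1, Set.mem_toFinset.1 i.2⟩ : b)) (by
      intro i j hij
      exact Subtype.ext (Subtype.mk.inj hij))
end

section
/- Let F be a field, let A be an r×n matrix with entries in F, and let t be an indeterminate. Let V be the n×r matrix over F[t] whose (i,j) entry is t^{i·j} for i ∈ {1, …, n} and j ∈ {1, …, r}. Then the rank of the r×r matrix A·V over the field of rational functions F(t) equals the rank of A over F. -/
theorem aux_rank_map_le {F K : Type*} [Field F] [Field K] (f : F →+* K) {r n : ℕ}
    (A : Matrix (Fin r) (Fin n) F) : (A.map f).rank ≤ A.rank := by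
  set W := LinearMap.range A.mulVecLin with hW
  have hr : A.rank = Module.finrank F W := rfl
  let b := Module.finBasis F W
  have hcol : ∀ j, A.col j ∈ W := fun j => ⟨Pi.single j 1, by simp⟩
  let B : Matrix (Fin r) (Fin (Module.finrank F W)) F := Matrix.of fun i k => (b k : Fin r → F) i
  let C : Matrix (Fin (Module.finrank F W)) (Fin n) F :=
    Matrix.of fun k j => b.repr ⟨A.col j, hcol j⟩ k
  have hA : A = B * C := by
    ext i j
    have h := b.sum_repr ⟨A.col j, hcol j⟩
    have h2 := congrFun (congrArg Subtype.val h) i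
    simp only [Submodule.coe_sum, Finset.sum_apply, Submodule.coe_smul, Pi.smul_apply,
      smul_eq_mul, Matrix.col_apply] at h2
    rw [Matrix.mul_apply, ← h2]
    exact Finset.sum_congr rfl fun k _ => mul_comm _ _
  have h3 : A.map f = B.map f * C.map f := by
    rw [← Matrix.map_mul, ← hA]
  rw [h3, hr]
  exact (Matrix.rank_mul_le_left _ _).trans (Matrix.rank_le_width _)

open Polynomial in
theorem aux_det {F : Type*} [Field F] {m : ℕ} (p : Fin m → F[X]) (h0 : ∀ i, p i ≠ 0)
    (hd : StrictMono fun i => (p i).natDegree) :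
    (Matrix.of fun i j : Fin m => expand F (j.1 + 1) (p i)).det ≠ 0 := by
  intro h
  have hc := congrArg (fun q => q.coeff (∑ i, (p i).natDegree * (i.1 + 1))) h
  simp only [Matrix.det_apply, finsetSum_coeff, coeff_zero] at hc
  rw [Finset.sum_eq_single 1] at hc
  · simp only [Equiv.Perm.sign_one, one_smul, Equiv.Perm.one_apply, Matrix.of_apply] at hc
    have hdeg : (∏ i, expand F (i.1 + 1) (p i)).natDegree
        = ∑ i, (p i).natDegree * (i.1 + 1) := by
      rw [natDegree_prod _ _ fun i _ => (expand_ne_zero (Nat.succ_pos _)).2 (h0 i)]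
      simp [natDegree_expand]
    rw [← hdeg, coeff_natDegree, leadingCoeff_eq_zero, Finset.prod_eq_zero_iff] at hc
    obtain ⟨i, _, hi⟩ := hc
    exact (expand_ne_zero (Nat.succ_pos _)).2 (h0 i) hi
  · intro σ _ hσ
    have hlt : ∑ i, (p (σ i)).natDegree * (i.1 + 1) < ∑ i, (p i).natDegree * (i.1 + 1) := by
      have hm : Monovary (fun i => (p i).natDegree) (fun i : Fin m => i.1 + 1) := by
        intro i j hij
        exact hd.monotone (show i ≤ j by simp at hij; exact hij.le)
      refine (hm.sum_comp_perm_mul_lt_sum_mul_iff (σ := σ)).2 fun hmon => hσ ?_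
      have hs : StrictMono σ := by
        intro i j hij
        have := hmon (i := i) (j := j) (by simpa using hij)
        exact lt_of_le_of_ne (hd.le_iff_le.1 this) fun e => hij.ne (σ.injective e)
      have := (StrictMono.range_inj hs strictMono_id).1 (by simp [σ.surjective.range_eq])
      ext i
      simp [this]
    have : (∏ i, expand F (i.1 + 1) (p (σ i))).coeff (∑ i, (p i).natDegree * (i.1 + 1)) = 0 := by
      apply coeff_eq_zero_of_natDegree_lt
      refine lt_of_le_of_lt (natDegree_prod_le _ _) ?_
      simpa [natDegree_expand] using hlt
    simp only [Matrix.of_apply, coeff_smul, this, smul_zero]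
  · simp

open Polynomial in
theorem aux_basis {F : Type*} [Field F] (W : Submodule F F[X]) (N : ℕ)
    (hN : ∀ p ∈ W, p.natDegree ≤ N) :
    ∃ p : Fin (Module.finrank F W) → F[X], (∀ i, p i ∈ W) ∧ (∀ i, p i ≠ 0) ∧
      StrictMono fun i => (p i).natDegree := by
  classical
  let D : Finset ℕ := (Finset.range (N + 1)).filter fun d => ∃ p ∈ W, p ≠ 0 ∧ p.natDegree = d
  have hD : ∀ d : ℕ, ∃ p : F[X], d ∈ D → p ∈ W ∧ p ≠ 0 ∧ p.natDegree = d := by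
    intro d
    by_cases h : d ∈ D
    · obtain ⟨p, hp⟩ := (Finset.mem_filter.1 h).2
      exact ⟨p, fun _ => hp⟩
    · exact ⟨0, fun h' => absurd h' h⟩
  choose q hq using hD
  have hspan : W ≤ Submodule.span F ((D.image q : Finset F[X]) : Set F[X]) := by
    have key : ∀ k : ℕ, ∀ p ∈ W, p.degree < k →
        p ∈ Submodule.span F ((D.image q : Finset F[X]) : Set F[X]) := by
      intro k
      induction k with
      | zero =>
        intro p _ h
        have : p = 0 := by
          rw [← degree_eq_bot]
          exact Nat.WithBot.lt_zero_iff.1 (by simpa using h)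
        rw [this]; exact zero_mem _
      | succ k ih =>
        intro p hp h
        by_cases h0 : p = 0
        · rw [h0]; exact zero_mem _
        have hdD : p.natDegree ∈ D :=
          Finset.mem_filter.2 ⟨Finset.mem_range.2 (Nat.lt_succ_of_le (hN p hp)), p, hp, h0, rfl⟩
        obtain ⟨hqW, hq0, hqd⟩ := hq _ hdD
        set g := q p.natDegree with hg
        set c := p.leadingCoeff / g.leadingCoeff with hc
        have hgl : g.leadingCoeff ≠ 0 := leadingCoeff_ne_zero.2 hq0
        have hpl : p.leadingCoeff ≠ 0 := leadingCoeff_ne_zero.2 h0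
        have hc0 : c ≠ 0 := div_ne_zero hpl hgl
        have hgs : g ∈ Submodule.span F ((D.image q : Finset F[X]) : Set F[X]) :=
          Submodule.subset_span (by
            rw [Finset.mem_coe]; exact Finset.mem_image_of_mem _ hdD)
        have hlt : (p - C c * g).degree < p.degree := by
          apply degree_sub_lt_left
          · rw [degree_C_mul hc0, degree_eq_natDegree h0, degree_eq_natDegree hq0, hqd]
          · exact h0
          · rw [leadingCoeff_mul, leadingCoeff_C, hc, div_mul_cancel₀ _ hgl]
        have hle : p.degree ≤ k := by
          rw [degree_eq_natDegree h0] at h ⊢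
          exact_mod_cast Nat.lt_succ_iff.1 (by exact_mod_cast h)
        have h1 := ih (p - C c * g) (by
          rw [← smul_eq_C_mul]; exact W.sub_mem hp (W.smul_mem _ hqW)) (hlt.trans_le hle)
        rw [← smul_eq_C_mul] at h1
        have := Submodule.add_mem _ h1 (Submodule.smul_mem _ c hgs)
        simpa using this
    intro p hp
    refine key (p.natDegree + 1) p hp ?_
    exact lt_of_le_of_lt degree_le_natDegree (by exact_mod_cast Nat.lt_succ_self _)
  have hcard : Module.finrank F W ≤ D.card :=
    (Submodule.finrank_mono hspan).trans
      ((finrank_span_finset_le_card _).trans Finset.card_image_le)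
  obtain ⟨D', hsub, hD'⟩ := Finset.exists_subset_card_eq hcard
  let e := D'.orderEmbOfFin hD'
  have he : ∀ i, e i ∈ D := fun i => hsub (Finset.orderEmbOfFin_mem _ _ _)
  refine ⟨fun i => q (e i), fun i => (hq _ (he i)).1, fun i => (hq _ (he i)).2.1, ?_⟩
  intro i j hij
  simp only [(hq _ (he _)).2.2]
  exact e.strictMono hij

open Polynomial in
theorem statement3 {F : Type*} [Field F] {r n : ℕ} (A : Matrix (Fin r) (Fin n) F) :
    ((A.map Polynomial.C *
        Matrix.of fun (i : Fin n) (j : Fin r) =>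
          (Polynomial.X : Polynomial F) ^ ((i.1 + 1) * (j.1 + 1))).map
        (algebraMap (Polynomial F) (RatFunc F))).rank = A.rank := by
  apply le_antisymm
  · rw [Matrix.map_mul]
    refine (Matrix.rank_mul_le_left _ _).trans ?_
    exact aux_rank_map_le ((algebraMap F[X] (RatFunc F)).comp C) A
  · let ψ : (Fin n → F) →ₗ[F] F[X] := ∑ i : Fin n, (monomial (i.1 + 1)).comp (LinearMap.proj i)
    have hψ : ∀ v, ψ v = ∑ i : Fin n, C (v i) * X ^ (i.1 + 1) := by
      intro v
      simp [ψ, C_mul_X_pow_eq_monomial]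
    have hinj : Function.Injective ψ := by
      rw [← LinearMap.ker_eq_bot, LinearMap.ker_eq_bot']
      intro v hv
      ext k
      have := congrArg (fun q => q.coeff (k.1 + 1)) hv
      simpa [hψ, coeff_X_pow, Fin.val_inj] using this
    set W := (LinearMap.range A.transpose.mulVecLin).map ψ with hW
    have hfr : Module.finrank F W = A.rank := by
      rw [← Matrix.rank_transpose]
      exact ((Submodule.equivMapOfInjective ψ hinj _).finrank_eq).symm
    have hdeg : ∀ p ∈ W, p.natDegree ≤ n := by
      rintro _ ⟨v, _, rfl⟩
      rw [hψ]
      refine natDegree_sum_le_of_forall_le _ _ fun i _ => ?_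
      exact (natDegree_C_mul_X_pow_le _ _).trans i.2
    obtain ⟨p, hpW, hp0, hpm⟩ := aux_basis W n hdeg
    have hmr : Module.finrank F W ≤ r := hfr ▸ Matrix.rank_le_height A
    rw [← hfr]
    have hex : ∀ i, ∃ c : Fin r → F, ψ (A.transpose.mulVec c) = p i := by
      intro i
      obtain ⟨_, ⟨c, rfl⟩, hv⟩ := hpW i
      exact ⟨c, hv⟩
    choose c hc using hex
    set M := A.map Polynomial.C * Matrix.of fun (i : Fin n) (j : Fin r) =>
          (Polynomial.X : Polynomial F) ^ ((i.1 + 1) * (j.1 + 1)) with hM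
    have hE : (((Matrix.of c).map C * M).submatrix id (Fin.castLE hmr)) =
        Matrix.of fun i j => expand F (j.1 + 1) (p i) := by
      ext1 i j
      rw [Matrix.submatrix_apply, hM, ← Matrix.mul_assoc, ← Matrix.map_mul, Matrix.of_apply, ← hc,
        hψ, Matrix.mul_apply, map_sum]
      refine Finset.sum_congr rfl fun l _ => ?_
      have : (Matrix.of c * A) i l = A.transpose.mulVec (c i) l := by
        rw [Matrix.mul_apply, Matrix.mulVec, dotProduct]
        exact Finset.sum_congr rfl fun k _ => mul_comm _ _
      rw [Matrix.map_apply, id, this, map_mul, expand_C, map_pow, expand_X, ← pow_mul,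
        Matrix.of_apply, Fin.val_castLE, mul_comm (j.1 + 1)]
    have hdet := aux_det p hp0 hpm
    rw [← hE] at hdet
    have hdet2 : ((((Matrix.of c).map C * M).submatrix id (Fin.castLE hmr)).map
        (algebraMap F[X] (RatFunc F))).det ≠ 0 := by
      rw [← RingHom.mapMatrix_apply, ← RingHom.map_det]
      exact fun h => hdet ((map_eq_zero_iff _ (RatFunc.algebraMap_injective F)).1 h)
    have h1 := Matrix.rank_of_det_ne_zero hdet2
    rw [Fintype.card_fin] at h1
    rw [← Matrix.submatrix_map, Matrix.map_mul] at h1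
    calc Module.finrank F W = _ := h1.symm
      _ ≤ _ := Matrix.rank_submatrix_le _ _ _
      _ ≤ _ := Matrix.rank_mul_le_right _ _
end

section
/- Let F be a field, let f_1, …, f_m ∈ F[x_1, …, x_n] be polynomials of total degree at most d with trdeg_F{f_1, …, f_m} ≤ r, and suppose char(F) = 0 or char(F) > d^r. Let Ψ : F[x_1, …, x_n] → F[z_1, …, z_p] be an F-algebra homomorphism such that the rank over F(x_1, …, x_n) of the Jacobian 𝒥_x(f_1, …, f_m) equals the rank over F(z_1, …, z_p) of the matrix obtained from 𝒥_x(f_1, …, f_m) by applying Ψ entrywise. Then the F-algebra homomorphism Φ : F[x_1, …, x_n] → F[z_1, …, z_p, t, y_1, …, y_r] defined by Φ(x_i) = (Σ_{j=1}^{r} y_j·t^{i·j}) + Ψ(x_i) is faithful to {f_1, …, f_m}, i.e. trdeg_F{f_1, …, f_m} = trdeg_F{Φ(f_1), …, Φ(f_m)}. -/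
open MvPolynomial

theorem chain_rule {R A ι : Type*} [CommRing R] [CommRing A] [Algebra R A] [Fintype ι]
    (D : Derivation R A A) (g : ι → A) (P : MvPolynomial ι R) :
    D (aeval g P) = ∑ i, aeval g (pderiv i P) * D (g i) := by
  classical
  induction P using MvPolynomial.induction_on with
  | C a => simp
  | add p q hp hq => simp [hp, hq, add_mul, Finset.sum_add_distrib]
  | mul_X p j hp =>
    simp only [map_mul, aeval_X, Derivation.leibniz, hp, smul_eq_mul, pderiv_X, map_add,
      add_mul, Finset.sum_add_distrib, Finset.mul_sum]
    congr 1
    · rw [Finset.sum_eq_single j]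
      · simp
      · intro b _ hb; simp [hb.symm]
      · simp
    · exact Finset.sum_congr rfl fun i _ => by ring

theorem totalDegree_pderiv_lt {k ι : Type*} [Field k] (P : MvPolynomial ι k) (i : ι)
    (h : pderiv i P ≠ 0) : (pderiv i P).totalDegree < P.totalDegree := by
  classical
  have key : ∀ m ∈ (pderiv i P).support, m.sum (fun _ e => e) + 1 ≤ P.totalDegree := by
    intro m hm
    rw [mem_support_iff, coeff_pderiv] at hm
    have h2 : m + Finsupp.single i 1 ∈ P.support := by
      rw [mem_support_iff]; exact left_ne_zero_of_mul hm
    have := le_totalDegree h2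
    rw [Finsupp.sum_add_index' (by simp) (by simp)] at this
    simpa using this
  obtain ⟨m, hm⟩ := support_nonempty.mpr h
  have := key m hm
  rw [totalDegree, Finset.sup_lt_iff (by simp; omega)]
  intro m hm; have := key m hm; exact this

theorem pow_linInd {k K : Type*} [Field k] [PerfectField k] [Field K] [Algebra k K] (p : ℕ)
    [Fact p.Prime] [ExpChar k p] [CharP k p] [CharP K p] (s : Finset K)
    (hs : LinearIndepOn k _root_.id (s : Set K)) : LinearIndepOn k (· ^ p) (s : Set K) := by
  apply hs.map_of_injective_injective (frobeniusEquiv k p).symm (frobenius K p).toAddMonoidHom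
  · simp
  · simp
  · intro r m
    change ((frobeniusEquiv k p).symm r • m) ^ p = r • m ^ p
    rw [Algebra.smul_def, Algebra.smul_def, mul_pow, ← map_pow]
    have : ((frobeniusEquiv k p).symm r) ^ p = r := (frobeniusEquiv k p).apply_symm_apply r
    rw [this]

theorem algInd_perfect {k σ ι : Type*} [Field k] [PerfectField k] [Fintype ι] [DecidableEq ι]
    (g : ι → MvPolynomial σ k) (e : ι → σ)
    (hdet : (Matrix.of fun i j => pderiv (e j) (g i)).det ≠ 0) : AlgebraicIndependent k g := by
  classical
  by_contra hcon
  rw [algebraicIndependent_iff] at hcon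
  push Not at hcon
  have hex : ∃ N, ∃ P : MvPolynomial ι k, P.totalDegree = N ∧ aeval g P = 0 ∧ P ≠ 0 := by
    obtain ⟨P, h1, h2⟩ := hcon; exact ⟨_, P, rfl, h1, h2⟩
  obtain ⟨P, hPN, hP0, hPne⟩ := Nat.find_spec hex
  have hmin : ∀ Q : MvPolynomial ι k, Q ≠ 0 → aeval g Q = 0 → P.totalDegree ≤ Q.totalDegree := by
    intro Q hQ hQ0
    rw [hPN]; exact Nat.find_min' hex ⟨Q, rfl, hQ0, hQ⟩
  have h1 : (fun i => aeval g (pderiv i P)) = 0 := by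
    by_contra hne
    apply hdet
    rw [← Matrix.exists_vecMul_eq_zero_iff]
    refine ⟨_, hne, ?_⟩
    ext1 j
    have := chain_rule (pderiv (e j)) g P
    rw [hP0, map_zero] at this
    simpa [Matrix.vecMul, dotProduct] using this.symm
  have h2 : ∀ i, pderiv i P = 0 := by
    intro i
    by_contra hne
    exact absurd (hmin _ hne (congrFun h1 i)) (not_le.mpr (totalDegree_pderiv_lt P i hne))
  have h3 : ∀ s ∈ P.support, ∀ i, ((s i : ℕ) : k) = 0 := by
    intro s hs i
    by_cases hi : s i = 0
    · simp [hi]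
    have := congrArg (coeff (s - Finsupp.single i 1)) (h2 i)
    rw [coeff_pderiv, tsub_add_cancel_of_le (by simpa [Nat.one_le_iff_ne_zero] using hi)] at this
    simp only [coeff_zero, mul_eq_zero] at this
    rcases this with h | h
    · exact absurd h (mem_support_iff.mp hs)
    · rw [← h]
      have : s i = (s - Finsupp.single i 1 : ι →₀ ℕ) i + 1 := by
        simp only [Finsupp.coe_tsub, Pi.sub_apply, Finsupp.single_eq_same]; omega
      rw [this]; push_cast; rfl
  obtain h0 | ⟨p, hp, hpk⟩ := CharP.exists' k
  · have : P = C (coeff 0 P) := by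
      rw [← totalDegree_eq_zero_iff_eq_C, totalDegree_eq_zero_iff]
      intro m hm x; exact_mod_cast h3 m hm x
    rw [this] at hP0 hPne
    simp only [aeval_C, algebraMap_eq, map_eq_zero_iff _ (C_injective σ k)] at hP0
    simp [hP0] at hPne
  · let K := FractionRing (MvPolynomial σ k)
    have : ExpChar k p := .prime hp.out
    have : CharP K p := .of_ringHom_of_ne_zero (algebraMap k K) p hp.out.ne_zero
    have key : ∀ Q : MvPolynomial ι k, aeval (fun i => algebraMap (MvPolynomial σ k) K (g i)) Q
        = algebraMap (MvPolynomial σ k) K (aeval g Q) := by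
      intro Q
      exact aeval_algebraMap_apply K g Q
    have := exists_mem_support_not_dvd_of_forall_totalDegree_le p hp.out (k := k) (K := K)
      (a := fun i => algebraMap (MvPolynomial σ k) K (g i)) (F := P) ?_ ?_ hPne ?_
    · obtain ⟨i, s, hs, hd⟩ := this
      exact hd ((CharP.cast_eq_zero_iff k p _).mp (h3 s hs i))
    · intro s hs
      exact pow_linInd p s hs
    · intro Q hQ hQ0
      rw [key] at hQ0
      exact hmin Q hQ (by simpa using hQ0)
    · rw [key, hP0, map_zero]

theorem algInd_of_det {k σ ι : Type*} [Field k] [Fintype ι] [DecidableEq ι]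
    (g : ι → MvPolynomial σ k) (e : ι → σ)
    (hdet : (Matrix.of fun i j => pderiv (e j) (g i)).det ≠ 0) : AlgebraicIndependent k g := by
  let φ : k →+* AlgebraicClosure k := algebraMap _ _
  have hφ : Function.Injective φ := φ.injective
  refine AlgebraicIndependent.of_ringHom_of_comp_eq φ (MvPolynomial.map (σ := σ) φ)
    (algInd_perfect _ e ?_) hφ ?_
  · have : (Matrix.of fun i j => pderiv (e j) ((MvPolynomial.map φ ∘ g) i)) =
      (MvPolynomial.map (σ := σ) φ).mapMatrix (Matrix.of fun i j => pderiv (e j) (g i)) := by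
      ext1 i j; simp [pderiv_map]
    rw [this, ← RingHom.map_det]
    exact (map_ne_zero_iff _ (map_injective φ hφ)).mpr hdet
  · ext a; simp [algebraMap_eq]


def simplexW (n : ℕ) (δ : Fin n → ℕ) (D : ℕ) : Finset (Fin n → ℕ) :=
  (Fintype.piFinset fun _ => Finset.range (D + 1)).filter (fun a => ∑ i, δ i * a i ≤ D)

theorem mem_simplexW {n : ℕ} {δ : Fin n → ℕ} (hδ : ∀ i, 1 ≤ δ i) {D : ℕ} {a : Fin n → ℕ} :
    a ∈ simplexW n δ D ↔ ∑ i, δ i * a i ≤ D := by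
  simp only [simplexW, Finset.mem_filter, Fintype.mem_piFinset, Finset.mem_range,
    and_iff_right_iff_imp]
  intro h i
  have h1 : δ i * a i ≤ ∑ i, δ i * a i :=
    Finset.single_le_sum (f := fun i => δ i * a i) (fun _ _ => Nat.zero_le _) (Finset.mem_univ i)
  have := Nat.le_mul_of_pos_left (a i) (hδ i)
  omega

theorem simplex_card_le (n : ℕ) (δ : Fin n → ℕ) (D : ℕ) :
    (simplexW n δ D).card ≤ (D + 1) ^ n := by
  refine (Finset.card_filter_le _ _).trans ?_
  simp

theorem simplex_compare (n : ℕ) (δ : Fin n → ℕ) (hδ : ∀ i, 1 ≤ δ i) (D : ℕ) :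
    (simplexW n (fun _ => 1) D).card ≤ (∏ i, δ i) * (simplexW n δ D).card := by
  classical
  refine Finset.card_le_mul_card_image_of_maps_to (f := fun b i => b i / δ i) ?_ _ ?_
  · intro b hb
    rw [mem_simplexW (by simp)] at hb
    rw [mem_simplexW hδ]
    refine le_trans (Finset.sum_le_sum fun i _ => ?_) hb
    simpa using Nat.mul_div_le _ _
  · intro a _
    have : (∏ i, δ i) = (Fintype.piFinset fun i => Finset.range (δ i)).card := by simp
    rw [this]
    refine Finset.card_le_card_of_injOn (fun b i => b i % δ i) ?_ ?_
    · intro b _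
      simp only [Finset.mem_coe, Fintype.mem_piFinset, Finset.mem_range]
      exact fun i => Nat.mod_lt _ (hδ i)
    · intro b hb b' hb' h
      simp only [Finset.coe_filter, Set.mem_ofPred_eq] at hb hb'
      funext i
      have h1 := congrFun h i
      have h2 := congrFun (hb.2.trans hb'.2.symm) i
      simp only at h1 h2
      rw [← Nat.div_add_mod (b i) (δ i), h1, h2, Nat.div_add_mod]

theorem growth (M c n : ℕ) (hM : 1 ≤ M) (N : ℕ → ℕ) (h0 : 1 ≤ N 0) (hN : ∀ D, N D ≤ (D + 1) ^ n)
    (h : ∀ D, (M + 1) * N D ≤ M * N (D + c)) : False := by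
  have h1 : ∀ j, (M + 1) ^ j ≤ M ^ j * N (j * c) := by
    intro j
    induction j with
    | zero => simpa using h0
    | succ j ih =>
      calc (M + 1) ^ (j + 1) = (M + 1) * (M + 1) ^ j := by ring
        _ ≤ (M + 1) * (M ^ j * N (j * c)) := Nat.mul_le_mul_left _ ih
        _ = M ^ j * ((M + 1) * N (j * c)) := by ring
        _ ≤ M ^ j * (M * N (j * c + c)) := Nat.mul_le_mul_left _ (h _)
        _ = M ^ (j + 1) * N ((j + 1) * c) := by rw [Nat.add_mul, one_mul]; ring
  have hMr : (0 : ℝ) < M := by exact_mod_cast hM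
  let r : ℝ := ((M : ℝ) + 1) / M
  have hr : 1 < r := by
    rw [one_lt_div hMr]; linarith
  have h2 : ∀ j : ℕ, 1 ≤ j → r ^ j ≤ ((c : ℝ) + 1) ^ n * (j : ℝ) ^ n := by
    intro j hj
    have h3 : (M + 1) ^ j ≤ M ^ j * ((c + 1) * j) ^ n := by
      refine (h1 j).trans (Nat.mul_le_mul_left _ ((hN _).trans (Nat.pow_le_pow_left ?_ _)))
      nlinarith
    have h4 : ((M : ℝ) + 1) ^ j ≤ (M : ℝ) ^ j * (((c : ℝ) + 1) * j) ^ n := by exact_mod_cast h3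
    rw [div_pow, div_le_iff₀ (by positivity), ← mul_pow, mul_comm]
    exact h4
  have h5 := tendsto_pow_const_div_const_pow_of_one_lt n hr
  have h6 := (h5.eventually_lt_const (u := 1 / ((c : ℝ) + 1) ^ n) (by positivity)).and
    (Filter.eventually_ge_atTop 1)
  obtain ⟨j, hj, hj1⟩ := h6.exists
  have h7 := h2 j hj1
  rw [div_lt_div_iff₀ (by positivity) (by positivity)] at hj
  linarith

theorem exists_annihilator {F : Type*} [Field F] {n : ℕ} (g : Fin n → MvPolynomial (Fin n) F)
    (δ : Fin n → ℕ) (hδ : ∀ i, 1 ≤ δ i) (hg : ∀ i, (g i).totalDegree ≤ δ i)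
    (h : MvPolynomial (Fin n) F) :
    ∃ P : Polynomial (MvPolynomial (Fin n) F), P ≠ 0 ∧ P.natDegree ≤ ∏ i, δ i ∧
      P.eval₂ (aeval g : MvPolynomial (Fin n) F →ₐ[F] MvPolynomial (Fin n) F).toRingHom h = 0 := by
  classical
  by_contra hcon
  push Not at hcon
  set M := ∏ i, δ i with hMdef
  have hM : 1 ≤ M := Nat.succ_le_of_lt (Finset.prod_pos fun i _ => hδ i)
  let N : ℕ → ℕ := fun D => (simplexW n (fun _ => 1) D).card
  refine growth M (M * h.totalDegree) n hM N ?_ (fun D => simplex_card_le n _ D) ?_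
  · refine Finset.card_pos.mpr ⟨0, ?_⟩
    rw [mem_simplexW (by simp)]; simp
  intro D
  suffices hs : (M + 1) * (simplexW n δ D).card ≤ N (D + M * h.totalDegree) by
    calc (M + 1) * N D ≤ (M + 1) * (M * (simplexW n δ D).card) :=
          Nat.mul_le_mul_left _ (simplex_compare n δ hδ D)
      _ = M * ((M + 1) * (simplexW n δ D).card) := by ring
      _ ≤ _ := Nat.mul_le_mul_left _ hs
  by_contra hlt
  push Not at hlt
  let A := simplexW n δ D
  let B := simplexW n (fun _ => 1) (D + M * h.totalDegree)
  let v : A × Fin (M + 1) → MvPolynomial (Fin n) F :=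
    fun x => (∏ i, g i ^ (x.1.1 i)) * h ^ (x.2.1)
  let T : ((A × Fin (M + 1)) → F) →ₗ[F] (B → F) :=
    LinearMap.pi fun b => (lcoeff F (Finsupp.equivFunOnFinite.symm b.1)) ∘ₗ
      (Fintype.linearCombination F v)
  have hker : LinearMap.ker T ≠ ⊥ := by
    apply LinearMap.ker_ne_bot_of_finrank_lt
    simp only [Module.finrank_fintype_fun_eq_card, Fintype.card_prod, Fintype.card_coe,
      Fintype.card_fin]
    rw [mul_comm]; exact hlt
  obtain ⟨u, hu, hu0⟩ := Submodule.exists_mem_ne_zero_of_ne_bot hker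
  have hvdeg : ∀ x, (v x).totalDegree ≤ D + M * h.totalDegree := by
    intro x
    refine (totalDegree_mul _ _).trans (Nat.add_le_add ?_ ?_)
    · refine (totalDegree_finsetProd _ _).trans ?_
      refine le_trans (Finset.sum_le_sum fun i _ => ?_) ((mem_simplexW hδ).mp x.1.2)
      refine (totalDegree_pow _ _).trans ?_
      rw [mul_comm]; exact Nat.mul_le_mul_right _ (hg i)
    · refine (totalDegree_pow _ _).trans (Nat.mul_le_mul_right _ ?_)
      have := x.2.2; omega
  have hQ : ∑ x, u x • v x = 0 := by
    ext b
    rw [coeff_zero]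
    by_cases hb : (b : Fin n → ℕ) ∈ B
    · have := congrFun (LinearMap.mem_ker.mp hu) ⟨b, hb⟩
      simp only [T, Fintype.linearCombination_apply, LinearMap.pi_apply, LinearMap.comp_apply,
        Pi.zero_apply] at this
      rw [coeff_sum]
      simpa using this
    · apply coeff_eq_zero_of_totalDegree_lt
      rw [mem_simplexW (by simp)] at hb
      push Not at hb
      refine lt_of_le_of_lt (b := D + M * h.totalDegree) ?_ ?_
      · refine totalDegree_finsetSum_le fun x _ => ?_
        exact (totalDegree_smul_le _ _).trans (hvdeg x)
      · refine lt_of_lt_of_eq hb ?_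
        simp only [one_mul]
        symm
        apply Finset.sum_subset (Finset.subset_univ _)
        intro i _ hi; simpa using hi
  let P : Polynomial (MvPolynomial (Fin n) F) :=
    ∑ x : A × Fin (M + 1), Polynomial.monomial x.2.1
      (monomial (Finsupp.equivFunOnFinite.symm x.1.1) (u x))
  refine hcon P ?_ ?_ ?_
  · obtain ⟨x, hx⟩ := Function.ne_iff.mp hu0
    intro hP
    apply hx
    have := congrArg (fun p => coeff (Finsupp.equivFunOnFinite.symm x.1.1) (p.coeff x.2.1)) hP
    simp only [P, Polynomial.finsetSum_coeff, Polynomial.coeff_monomial, coeff_sum] at this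
    rw [Finset.sum_eq_single x] at this
    · simpa using this
    · intro y _ hy
      split_ifs with h1
      · rw [coeff_monomial, if_neg]
        intro h2
        apply hy
        exact Prod.ext (Subtype.ext (Finsupp.equivFunOnFinite.symm.injective h2)) (Fin.ext h1)
      · simp
    · simp
  · refine Polynomial.natDegree_sum_le_of_forall_le _ _ fun x _ => ?_
    refine (Polynomial.natDegree_monomial_le _).trans ?_
    have := x.2.2; omega
  · rw [← hQ]
    simp only [P, Polynomial.eval₂_finsetSum, Polynomial.eval₂_monomial]
    refine Finset.sum_congr rfl fun x _ => ?_
    simp only [AlgHom.toRingHom_eq_coe, RingHom.coe_coe, aeval_monomial, v, algebraMap_eq]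
    rw [Finsupp.prod_fintype _ _ (by simp), smul_eq_C_mul, mul_assoc]
    rfl

theorem deriv_eval₂ {F A B : Type*} [CommRing F] [CommRing A] [CommRing B] [Algebra F B]
    (D : Derivation F B B) (φ : A →+* B) (hφ : ∀ a, D (φ a) = 0) (h : B) (P : Polynomial A) :
    D (P.eval₂ φ h) = P.derivative.eval₂ φ h * D h := by
  induction P using Polynomial.induction_on' with
  | add p q hp hq => simp [Polynomial.eval₂_add, hp, hq, add_mul]
  | monomial k a =>
    simp only [Polynomial.eval₂_monomial, Derivation.leibniz, hφ, Derivation.leibniz_pow,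
      Polynomial.derivative_monomial, smul_eq_mul, map_mul, map_natCast, nsmul_eq_mul]
    ring

theorem jac_det_ne_zero {F : Type*} [Field F] {n : ℕ} (g : Fin n → MvPolynomial (Fin n) F)
    (δ : Fin n → ℕ) (hδ : ∀ i, 1 ≤ δ i) (hg : ∀ i, (g i).totalDegree ≤ δ i)
    (hind : AlgebraicIndependent F g)
    (hchar : ringChar F = 0 ∨ ∏ i, δ i < ringChar F) :
    (Matrix.of fun i j => pderiv j (g i)).det ≠ 0 := by
  classical
  intro hdet
  rw [← Matrix.exists_mulVec_eq_zero_iff] at hdet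
  obtain ⟨v, hv, hJv⟩ := hdet
  let D : Derivation F (MvPolynomial (Fin n) F) (MvPolynomial (Fin n) F) := mkDerivation F v
  have hDg : ∀ i, D (g i) = 0 := by
    intro i
    have := chain_rule D (X : Fin n → MvPolynomial (Fin n) F) (g i)
    rw [aeval_X_left_apply] at this
    rw [this]
    have h2 := congrFun hJv i
    simpa [Matrix.mulVec, dotProduct, D, mkDerivation_X] using h2
  have hDφ : ∀ a, D ((aeval g : MvPolynomial (Fin n) F →ₐ[F] MvPolynomial (Fin n) F).toRingHom a)
      = 0 := by
    intro a
    have := chain_rule D g a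
    simpa [hDg] using this
  apply hv
  funext l
  have hex : ∃ N, ∃ P : Polynomial (MvPolynomial (Fin n) F), P.natDegree = N ∧ P ≠ 0 ∧
      P.eval₂ (aeval g : MvPolynomial (Fin n) F →ₐ[F] MvPolynomial (Fin n) F).toRingHom (X l) = 0 := by
    obtain ⟨P, h1, h2, h3⟩ := exists_annihilator g δ hδ hg (X l)
    exact ⟨_, P, rfl, h1, h3⟩
  have hbd : Nat.find hex ≤ ∏ i, δ i := by
    obtain ⟨P, h1, h2, h3⟩ := exists_annihilator g δ hδ hg (X l)
    exact (Nat.find_min' hex ⟨P, rfl, h1, h3⟩).trans h2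
  obtain ⟨P, hPN, hP, hP0⟩ := Nat.find_spec hex
  have hdeg : P.natDegree ≠ 0 := by
    intro h0
    rw [Polynomial.eq_C_of_natDegree_eq_zero h0] at hP0 hP
    rw [Polynomial.eval₂_C] at hP0
    apply hP
    have : P.coeff 0 = 0 := (algebraicIndependent_iff.mp hind) _ hP0
    rw [this, map_zero]
  have hcast : ((P.natDegree : ℕ) : F) ≠ 0 := by
    intro h0
    have h1 := (ringChar.spec F _).mp h0
    rcases hchar with hc | hc
    · rw [hc, zero_dvd_iff] at h1; exact hdeg h1
    · have := Nat.le_of_dvd (Nat.pos_of_ne_zero hdeg) h1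
      omega
  have hder : P.derivative ≠ 0 := by
    intro h0
    have := congrArg (fun q => q.coeff (P.natDegree - 1)) h0
    simp only [Polynomial.coeff_derivative, Polynomial.coeff_zero] at this
    rw [Nat.sub_add_cancel (Nat.pos_of_ne_zero hdeg)] at this
    have h2 : (((P.natDegree - 1 : ℕ) : MvPolynomial (Fin n) F) + 1) = C ((P.natDegree : ℕ) : F) := by
      rw [← Nat.cast_succ, Nat.succ_eq_add_one, Nat.sub_add_cancel (Nat.pos_of_ne_zero hdeg)]
      simp
    rw [h2] at this
    rcases mul_eq_zero.mp this with h | h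
    · exact hP (Polynomial.leadingCoeff_eq_zero.mp h)
    · exact hcast (C_injective _ _ (h.trans (map_zero C).symm))
  have hne : P.derivative.eval₂
      (aeval g : MvPolynomial (Fin n) F →ₐ[F] MvPolynomial (Fin n) F).toRingHom (X l) ≠ 0 := by
    intro h0
    have := Nat.find_min' hex ⟨P.derivative, rfl, hder, h0⟩
    rw [← hPN] at this
    exact absurd this (not_le.mpr (Polynomial.natDegree_derivative_lt hdeg))
  have := deriv_eval₂ D _ hDφ (X l) P
  rw [hP0, map_zero] at this
  have h3 := (mul_eq_zero.mp this.symm).resolve_left hne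
  simpa [D, mkDerivation_X] using h3

theorem jac_linInd {F : Type*} [Field F] {n s d : ℕ} (f : Fin s → MvPolynomial (Fin n) F)
    (hf : ∀ i, (f i).totalDegree ≤ d)
    (hind : AlgebraicIndependent F f)
    (hchar : ringChar F = 0 ∨ d ^ s < ringChar F) (hd : 1 ≤ d) :
    LinearIndependent (FractionRing (MvPolynomial (Fin n) F)) (fun i j =>
      algebraMap (MvPolynomial (Fin n) F) (FractionRing (MvPolynomial (Fin n) F))
        (pderiv j (f i))) := by
  classical
  let R := MvPolynomial (Fin n) F
  have halg : Algebra.IsAlgebraic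
      (Algebra.adjoin F (Set.range f ∪ Set.range (X : Fin n → R))) R := by
    have : Algebra.adjoin F (Set.range f ∪ Set.range (X : Fin n → R)) = ⊤ := by
      rw [eq_top_iff, ← adjoin_range_X]
      exact Algebra.adjoin_mono Set.subset_union_right
    rw [this]
    refine ⟨fun x => ?_⟩
    exact isAlgebraic_algebraMap (⟨x, trivial⟩ : (⊤ : Subalgebra F R))
  obtain ⟨B, hB1, hB2, hB⟩ := exists_isTranscendenceBasis_between (R := F) (Set.range f)
    (Set.range f ∪ Set.range (X : Fin n → R)) Set.subset_union_left hind.coe_range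
  have hX : IsTranscendenceBasis F (X : Fin n → R) := IsTranscendenceBasis.mvPolynomial _ _
  have hcard := hB.lift_cardinalMk_eq hX
  rw [Cardinal.lift_mk_eq'] at hcard
  obtain ⟨e⟩ := hcard
  let g : Fin n → R := fun i => (e.symm i : R)
  have hginj : Function.Injective g := Subtype.val_injective.comp e.symm.injective
  have hgind : AlgebraicIndependent F g := hB.1.comp e.symm e.symm.injective
  let δ : Fin n → ℕ := fun i => if g i ∈ Set.range f then d else 1
  have hδ : ∀ i, 1 ≤ δ i := by
    intro i; simp only [δ]; split_ifs <;> omega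
  have hgδ : ∀ i, (g i).totalDegree ≤ δ i := by
    intro i; simp only [δ]; split_ifs with h
    · obtain ⟨k, hk⟩ := h; rw [← hk]; exact hf k
    · obtain ⟨k, hk⟩ := (hB2 (e.symm i).2).resolve_left h
      change X k = g i at hk
      rw [← hk]; simp
  have hprod : ∏ i, δ i ≤ d ^ s := by
    simp only [δ, Finset.prod_ite, Finset.prod_const, one_pow, mul_one]
    refine Nat.pow_le_pow_right hd ?_
    rw [← Finset.card_image_of_injective _ hginj]
    refine (Finset.card_le_card (t := Finset.univ.image f) ?_).trans
      (Finset.card_image_le.trans (by simp))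
    intro x hx
    simp only [Finset.mem_image, Finset.mem_filter, Finset.mem_univ, true_and] at hx ⊢
    obtain ⟨i, ⟨k, hk⟩, rfl⟩ := hx
    exact ⟨k, hk⟩
  have hdet := jac_det_ne_zero g δ hδ hgδ hgind (hchar.imp id (lt_of_le_of_lt hprod))
  have hdet2 : ((algebraMap R (FractionRing R)).mapMatrix
      (Matrix.of fun i j => pderiv j (g i))).det ≠ 0 := by
    rw [← RingHom.map_det]
    exact (map_ne_zero_iff _ (IsFractionRing.injective R (FractionRing R))).mpr hdet
  have hli := Matrix.linearIndependent_rows_of_det_ne_zero hdet2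
  let τ : Fin s → Fin n := fun i => e ⟨f i, hB1 ⟨i, rfl⟩⟩
  have hgτ : ∀ i, g (τ i) = f i := fun i => by simp [g, τ]
  have hτ : Function.Injective τ := by
    intro i j hij
    apply hind.injective
    rw [← hgτ, ← hgτ, hij]
  have := hli.comp τ hτ
  have heq : (fun i j => algebraMap (MvPolynomial (Fin n) F) (FractionRing (MvPolynomial (Fin n) F))
        (pderiv j (f i))) = ((fun i => (algebraMap R (FractionRing R)).mapMatrix
          (Matrix.of fun i j => (pderiv j) (g i)) i) ∘ τ) := by
    funext i j
    simp only [Function.comp_apply, RingHom.mapMatrix_apply, Matrix.map_apply, Matrix.of_apply, hgτ]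
    rfl
  rw [heq]
  exact this

theorem trop_twice {K : Type*} [Field K] {s : ℕ} (c : Fin s → Polynomial K) (hc : c ≠ 0)
    (q : Polynomial K) (hq : q ≠ 0)
    (hsum : ∑ j : Fin s, Polynomial.expand K (j.1 + 1) q * c j = 0) :
    ∃ j₁ j₂ : Fin s, j₁ < j₂ ∧ c j₁ ≠ 0 ∧ c j₂ ≠ 0 ∧
      (∀ j, c j ≠ 0 → (c j).natDegree + (j.1 + 1) * q.natDegree ≤
        (c j₁).natDegree + (j₁.1 + 1) * q.natDegree) ∧
      (∀ j, c j ≠ 0 → (c j).natDegree + (j.1 + 1) * q.natDegree ≤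
        (c j₂).natDegree + (j₂.1 + 1) * q.natDegree) := by
  classical
  let W : Fin s → ℕ := fun j => (c j).natDegree + (j.1 + 1) * q.natDegree
  obtain ⟨k, hk⟩ := Function.ne_iff.mp hc
  obtain ⟨j0, hj0, hmax⟩ := Finset.exists_max_image (Finset.univ.filter fun j => c j ≠ 0) W
    ⟨k, by simpa using hk⟩
  simp only [Finset.mem_filter, Finset.mem_univ, true_and] at hj0 hmax
  have hexp : ∀ j : Fin s, (Polynomial.expand K (j.1 + 1) q * c j).natDegree ≤ W j := by
    intro j
    refine Polynomial.natDegree_mul_le.trans ?_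
    rw [Polynomial.natDegree_expand]
    simp only [W]
    rw [add_comm, mul_comm]
  have hex : ∃ j, j ≠ j0 ∧ c j ≠ 0 ∧ W j0 ≤ W j := by
    by_contra hcon
    push Not at hcon
    have h1 := congrArg (fun p => p.coeff (W j0)) hsum
    simp only [Polynomial.finsetSum_coeff, Polynomial.coeff_zero] at h1
    rw [Finset.sum_eq_single j0] at h1
    · have hW : W j0 = (Polynomial.expand K (j0.1 + 1) q * c j0).natDegree := by
        rw [Polynomial.natDegree_mul, Polynomial.natDegree_expand]
        · simp only [W]; ring
        · exact (Polynomial.expand_ne_zero (Nat.succ_pos _)).mpr hq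
        · exact hj0
      rw [hW, Polynomial.coeff_natDegree, Polynomial.leadingCoeff_eq_zero] at h1
      rcases mul_eq_zero.mp h1 with h | h
      · exact (Polynomial.expand_ne_zero (Nat.succ_pos _)).mpr hq h
      · exact hj0 h
    · intro j _ hj
      by_cases hcj : c j = 0
      · simp [hcj]
      · apply Polynomial.coeff_eq_zero_of_natDegree_lt
        exact (hexp j).trans_lt (hcon j hj hcj)
    · simp
  obtain ⟨j, hjne, hcj, hWj⟩ := hex
  rcases lt_or_gt_of_ne hjne with h | h
  · exact ⟨j, j0, h, hcj, hj0, fun i hi => (hmax i hi).trans hWj, hmax⟩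
  · exact ⟨j0, j, h, hj0, hcj, hmax, fun i hi => (hmax i hi).trans hWj⟩

theorem gabizon_raz {K : Type*} [Field K] {s : ℕ} (q : Fin s → Polynomial K)
    (hq : LinearIndependent K q) :
    (Matrix.of fun i j : Fin s => Polynomial.expand K (j.1 + 1) (q i)).det ≠ 0 := by
  classical
  intro hdet
  rw [← Matrix.exists_mulVec_eq_zero_iff] at hdet
  obtain ⟨c, hc, hMc⟩ := hdet
  have hs : 0 < s := by
    rcases Nat.eq_zero_or_pos s with h | h
    · subst h; exact absurd (Subsingleton.elim c 0) hc
    · exact h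
  let V := Submodule.span K (Set.range q)
  have hV : ∀ p ∈ V, ∑ j : Fin s, Polynomial.expand K (j.1 + 1) p * c j = 0 := by
    intro p hp
    induction hp using Submodule.span_induction with
    | mem x hx =>
      obtain ⟨i, rfl⟩ := hx
      simpa [Matrix.mulVec, dotProduct] using congrFun hMc i
    | zero => simp
    | add x y _ _ hx hy => simp [add_mul, Finset.sum_add_distrib, hx, hy]
    | smul a x _ hx =>
      simp only [map_smul, smul_mul_assoc, ← Finset.smul_sum, hx, smul_zero]
  let E : Set ℕ := {l | ∃ p ∈ V, p ≠ 0 ∧ p.natDegree = l}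
  have hE : ∀ l : E, ∃ j₁ j₂ : Fin s, j₁ < j₂ ∧ c j₁ ≠ 0 ∧ c j₂ ≠ 0 ∧
      (∀ j, c j ≠ 0 → (c j).natDegree + (j.1 + 1) * l.1 ≤
        (c j₁).natDegree + (j₁.1 + 1) * l.1) ∧
      (∀ j, c j ≠ 0 → (c j).natDegree + (j.1 + 1) * l.1 ≤
        (c j₂).natDegree + (j₂.1 + 1) * l.1) := by
    rintro ⟨l, p, hp, hp0, rfl⟩
    exact trop_twice c hc p hp0 (hV p hp)
  choose j₁ j₂ hlt hc1 hc2 hm1 hm2 using hE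
  have hmono : ∀ l l' : E, l.1 < l'.1 → j₂ l < j₂ l' := by
    intro l l' hll
    refine lt_of_le_of_lt ?_ (hlt l')
    have h1 := hm2 l (j₁ l') (hc1 l')
    have h2 := hm1 l' (j₂ l) (hc2 l)
    by_contra hcon
    have h3 : (j₁ l').1 < (j₂ l).1 := not_le.mp hcon
    nlinarith
  let Φ : E → {j : Fin s // j ≠ ⟨0, hs⟩} := fun l => ⟨j₂ l, by
    intro h
    have := hlt l
    rw [h] at this
    exact absurd this (Nat.not_lt_zero _)⟩
  have hΦ : Function.Injective Φ := by
    intro l l' h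
    have h' : j₂ l = j₂ l' := congrArg Subtype.val h
    rcases lt_trichotomy l.1 l'.1 with h1 | h1 | h1
    · exact absurd h' (hmono _ _ h1).ne
    · exact Subtype.ext h1
    · exact absurd h' (hmono _ _ h1).ne'
  have : Finite E := Finite.of_injective Φ hΦ
  have : Fintype E := Fintype.ofFinite E
  have hcE : Fintype.card E < s := by
    refine (Fintype.card_le_of_injective Φ hΦ).trans_lt ?_
    have := Fintype.card_subtype_lt (p := fun j : Fin s => j ≠ ⟨0, hs⟩) (x := ⟨0, hs⟩) (by simp)
    simpa using this
  let T : V →ₗ[K] (E → K) := LinearMap.pi fun l => Polynomial.lcoeff K l.1 ∘ₗ V.subtype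
  have hT : Function.Injective T := by
    rw [injective_iff_map_eq_zero]
    rintro ⟨p, hp⟩ h0
    by_contra hne
    have hp0 : p ≠ 0 := fun h => hne (Subtype.ext h)
    have := congrFun h0 ⟨p.natDegree, p, hp, hp0, rfl⟩
    simp [T] at this
    exact hp0 this
  have h1 := LinearMap.finrank_le_finrank_of_injective hT
  rw [Module.finrank_fintype_fun_eq_card, finrank_span_eq_card hq, Fintype.card_fin] at h1
  omega

theorem trdegFam_bdd {F A : Type*} [CommRing F] [CommRing A] [Algebra F A]
    {m : ℕ} (f : Fin m → A) : BddAbove {k : ℕ | ∃ S : Finset (Fin m), S.card = k ∧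
    AlgebraicIndependent F (fun i : {x // x ∈ S} => f i)} := by
  refine ⟨m, ?_⟩
  rintro k ⟨S, rfl, -⟩
  simpa using Finset.card_le_univ S

theorem trdegFam_spec {F A : Type*} [Field F] [CommRing A] [Nontrivial A] [Algebra F A]
    {m : ℕ} (f : Fin m → A) : ∃ S : Finset (Fin m), S.card = trdegFam F f ∧
    AlgebraicIndependent F (fun i : {x // x ∈ S} => f i) := by
  refine Nat.sSup_mem (s := {k : ℕ | ∃ S : Finset (Fin m), S.card = k ∧
    AlgebraicIndependent F (fun i : {x // x ∈ S} => f i)}) ⟨0, ∅, rfl, ?_⟩ (trdegFam_bdd f)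
  rw [algebraicIndependent_empty_type_iff]
  exact (algebraMap F A).injective

theorem le_trdegFam {F A : Type*} [CommRing F] [CommRing A] [Algebra F A]
    {m : ℕ} (f : Fin m → A) (S : Finset (Fin m))
    (h : AlgebraicIndependent F (fun i : {x // x ∈ S} => f i)) : S.card ≤ trdegFam F f :=
  le_csSup (trdegFam_bdd f) ⟨S, rfl, h⟩

theorem le_trdegFam' {F A : Type*} [Field F] [CommRing A] [Nontrivial A] [Algebra F A]
    {m s : ℕ} (f : Fin m → A) (ρ : Fin s → Fin m)
    (h : AlgebraicIndependent F (fun i => f (ρ i))) : s ≤ trdegFam F f := by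
  classical
  have hρ : Function.Injective ρ := fun i j hij => h.injective (by simp [hij])
  have hc : (Finset.univ.image ρ).card = s := by
    rw [Finset.card_image_of_injective _ hρ]; simp
  rw [← hc]
  apply le_trdegFam
  have hex : ∀ x : {x // x ∈ Finset.univ.image ρ}, ∃ i, ρ i = x.1 := by
    rintro ⟨x, hx⟩; simpa using hx
  choose τ hτ using hex
  have := h.comp τ (fun x y hxy => Subtype.ext (by rw [← hτ, ← hτ, hxy]))
  simpa [Function.comp_def, hτ] using this

theorem trdegFam_spec' {F A : Type*} [Field F] [CommRing A] [Nontrivial A] [Algebra F A]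
    {m : ℕ} (f : Fin m → A) : ∃ ρ : Fin (trdegFam F f) → Fin m,
    AlgebraicIndependent F (fun i => f (ρ i)) := by
  obtain ⟨S, hS, h⟩ := trdegFam_spec (F := F) f
  let e := S.equivFinOfCardEq hS
  exact ⟨fun i => (e.symm i).1, h.comp e.symm e.symm.injective⟩

theorem exists_rows {K : Type*} [Field K] {m n s : ℕ} (M : Matrix (Fin m) (Fin n) K)
    (h : s ≤ M.rank) : ∃ ρ : Fin s → Fin m, LinearIndependent K (fun i => M (ρ i)) := by
  rw [Matrix.rank_eq_finrank_span_row] at h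
  obtain ⟨w, hw, -, hli⟩ := Submodule.exists_fun_fin_finrank_span_eq K (Set.range M.row)
  choose τ hτ using hw
  refine ⟨fun i => τ (Fin.castLE h i), ?_⟩
  have := hli.comp (Fin.castLE h) (Fin.castLE_injective h)
  have e : (fun i => M (τ (Fin.castLE h i))) = w ∘ Fin.castLE h := by
    funext i
    exact hτ _
  rw [e]
  exact this

theorem le_rank {K : Type*} [Field K] {m n s : ℕ} (M : Matrix (Fin m) (Fin n) K)
    (ρ : Fin s → Fin m) (h : LinearIndependent K (fun i => M (ρ i))) : s ≤ M.rank := by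
  have h1 : (M.submatrix ρ id).rank = Fintype.card (Fin s) := LinearIndependent.rank_matrix h
  rw [Fintype.card_fin] at h1
  rw [← h1, Matrix.rank_eq_finrank_span_row, Matrix.rank_eq_finrank_span_row]
  apply Submodule.finrank_mono
  apply Submodule.span_mono
  rintro _ ⟨i, rfl⟩
  exact ⟨ρ i, rfl⟩

theorem rows_poly_linInd {K : Type*} [Field K] {n s : ℕ} (w : Fin s → Fin n → K)
    (h : LinearIndependent K w) : LinearIndependent K
      (fun i => ∑ l : Fin n, Polynomial.monomial (l.1 + 1) (w i l)) := by
  let L : (Fin n → K) →ₗ[K] Polynomial K :=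
    ∑ l : Fin n, Polynomial.monomial (l.1 + 1) ∘ₗ LinearMap.proj l
  have hL : ∀ v, L v = ∑ l : Fin n, Polynomial.monomial (l.1 + 1) (v l) := by
    intro v; simp [L, LinearMap.sum_apply]
  have := h.map' L (by
    rw [LinearMap.ker_eq_bot']
    intro v hv
    funext k
    rw [hL] at hv
    have := congrArg (fun p => p.coeff (k.1 + 1)) hv
    simpa [Polynomial.finsetSum_coeff, Polynomial.coeff_monomial, ← Fin.ext_iff] using this)
  have e : (fun i => ∑ l : Fin n, Polynomial.monomial (l.1 + 1) (w i l)) = L ∘ w := by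
    funext i
    exact (hL _).symm
  rw [e]
  exact this

theorem statement5 {F : Type*} [Field F] {n m d r p : ℕ}
    (f : Fin m → MvPolynomial (Fin n) F)
    (hdeg : ∀ i, (f i).totalDegree ≤ d)
    (htd : trdegFam F f ≤ r)
    (hchar : ringChar F = 0 ∨ d ^ r < ringChar F)
    (Ψ : MvPolynomial (Fin n) F →ₐ[F] MvPolynomial (Fin p) F)
    (hrank :
      (Matrix.of fun (i : Fin m) (j : Fin n) =>
        algebraMap (MvPolynomial (Fin n) F) (FractionRing (MvPolynomial (Fin n) F))
          (pderiv j (f i))).rank =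
      (Matrix.of fun (i : Fin m) (j : Fin n) =>
        algebraMap (MvPolynomial (Fin p) F) (FractionRing (MvPolynomial (Fin p) F))
          (Ψ (pderiv j (f i)))).rank) :
    trdegFam F f = trdegFam F fun i =>
      (aeval fun i' : Fin n =>
          (∑ j : Fin r,
            (X (Sum.inr (Sum.inr j)) : MvPolynomial (Fin p ⊕ (Unit ⊕ Fin r)) F) *
              X (Sum.inr (Sum.inl ())) ^ ((i'.1 + 1) * (j.1 + 1))) +
          rename Sum.inl (Ψ (X i')))
        (f i) := by
  classical
  set G : Fin n → MvPolynomial (Fin p ⊕ (Unit ⊕ Fin r)) F := fun i' : Fin n =>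
          (∑ j : Fin r,
            (X (Sum.inr (Sum.inr j)) : MvPolynomial (Fin p ⊕ (Unit ⊕ Fin r)) F) *
              X (Sum.inr (Sum.inl ())) ^ ((i'.1 + 1) * (j.1 + 1))) +
          rename Sum.inl (Ψ (X i')) with hG
  apply le_antisymm
  swap
  · obtain ⟨ρ, hρ⟩ := trdegFam_spec' (F := F) (fun i => aeval G (f i))
    exact le_trdegFam' f ρ (AlgebraicIndependent.of_comp (aeval G) hρ)
  obtain ⟨ρ₀, hρ₀⟩ := trdegFam_spec' (F := F) f
  generalize trdegFam F f = s at htd ρ₀ hρ₀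
  rcases Nat.eq_zero_or_pos s with hs | hs
  · omega
  have hd : 1 ≤ d := by
    by_contra hd
    have h0 : (f (ρ₀ ⟨0, hs⟩)).totalDegree = 0 := by
      have := hdeg (ρ₀ ⟨0, hs⟩); omega
    have h1 := hρ₀.transcendental ⟨0, hs⟩
    apply h1
    rw [totalDegree_eq_zero_iff_eq_C.mp h0]
    exact isAlgebraic_algebraMap _
  have hli := jac_linInd (fun i => f (ρ₀ i)) (fun i => hdeg _) hρ₀
    (hchar.imp id (lt_of_le_of_lt (Nat.pow_le_pow_right hd htd))) hd
  have hrk := le_rank (Matrix.of fun (i : Fin m) (j : Fin n) =>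
        algebraMap (MvPolynomial (Fin n) F) (FractionRing (MvPolynomial (Fin n) F))
          (pderiv j (f i))) ρ₀ hli
  rw [hrank] at hrk
  obtain ⟨ρ, hρ⟩ := exists_rows _ hrk
  have hdet := gabizon_raz _ (rows_poly_linInd _ hρ)
  refine le_trdegFam' _ ρ ?_
  refine algInd_of_det _ (fun j : Fin s => Sum.inr (Sum.inr (Fin.castLE htd j))) ?_
  let K := FractionRing (MvPolynomial (Fin p) F)
  let π : MvPolynomial (Fin p ⊕ (Unit ⊕ Fin r)) F →ₐ[F] Polynomial K :=
    aeval (Sum.elim (fun z => Polynomial.C (algebraMap (MvPolynomial (Fin p) F) K (X z)))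
      (Sum.elim (fun _ => Polynomial.X) (fun _ => 0)))
  have hπr : ∀ h : MvPolynomial (Fin p) F, π (rename Sum.inl h) =
      Polynomial.C (algebraMap (MvPolynomial (Fin p) F) K h) := by
    intro h
    induction h using MvPolynomial.induction_on with
    | C a =>
      simp only [rename_C, π, aeval_C]
      rfl
    | add p q hp hq => simp only [map_add, hp, hq]
    | mul_X p i hp => simp only [map_mul, hp, rename_X]; congr 1; simp [π]
  have hπG : ∀ h : MvPolynomial (Fin n) F, π (aeval G h) =
      Polynomial.C (algebraMap (MvPolynomial (Fin p) F) K (Ψ h)) := by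
    intro h
    rw [← hπr]
    induction h using MvPolynomial.induction_on with
    | C a => simp only [aeval_C, ← algebraMap_eq, AlgHom.commutes]
    | add p q hp hq => simp only [map_add, hp, hq]
    | mul_X p i hp =>
      simp only [map_mul, hp, aeval_X]
      congr 1
      simp [hG, π]
  have hpd : ∀ (j : Fin r) (l : Fin n), pderiv (Sum.inr (Sum.inr j)) (G l) =
      X (Sum.inr (Sum.inl ())) ^ ((l.1 + 1) * (j.1 + 1)) := by
    intro j l
    have h1 : pderiv (Sum.inr (Sum.inr j)) (rename Sum.inl (Ψ (X l)) :
        MvPolynomial (Fin p ⊕ (Unit ⊕ Fin r)) F) = 0 := by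
      apply pderiv_eq_zero_of_notMem_vars
      intro hmem
      have := vars_rename _ _ hmem
      simp at this
    simp only [hG, map_add, h1, add_zero, map_sum]
    rw [Finset.sum_eq_single j]
    · simp [pderiv_mul, pderiv_pow]
    · intro b _ hb
      have : (Sum.inr (Sum.inr b) : Fin p ⊕ (Unit ⊕ Fin r)) ≠ Sum.inr (Sum.inr j) := by simpa using hb
      simp [pderiv_mul, pderiv_pow, pderiv_X_of_ne this]
    · simp
  intro h0
  apply hdet
  have h1 := congrArg π.toRingHom h0
  rw [RingHom.map_det, map_zero] at h1
  rw [← h1]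
  congr 1
  ext1 i j
  simp only [Matrix.of_apply, RingHom.mapMatrix_apply, Matrix.map_apply, chain_rule _ G, hpd]
  simp only [AlgHom.toRingHom_eq_coe, RingHom.coe_coe, map_sum, map_mul, hπG, map_pow]
  refine Finset.sum_congr rfl fun l _ => ?_
  have hX : π (X (Sum.inr (Sum.inl ()))) = Polynomial.X := by simp [π]
  rw [hX, Polynomial.expand_monomial, Polynomial.C_mul_X_pow_eq_monomial]
  rfl
end

section
/- Let F be a field of characteristic zero and let M = (x_{ij}) be the n×n matrix of distinct indeterminates. Let M_1, …, M_t be the first-order principal minors of M with respect to t distinct diagonal indices, and let f_1, …, f_t ∈ F[x_{11}, …, x_{nn}], not all zero, satisfy Σ_{i=1}^{t} f_i · M_i = 0. Then the total sparsity Σ_{i=1}^{t} sparsity(f_i) is at least 2^{n/2 − t}. -/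
open MvPolynomial

namespace S8

set_option linter.unusedSectionVars false

open Equiv Finset

section top
variable {F : Type*} [Field F] {σ : Type*} {Γ : Type*}
  [AddCommGroup Γ] [LinearOrder Γ] [IsOrderedAddMonoid Γ]

open Classical in
/-- weight `e` part -/
noncomputable def top (W : (σ →₀ ℕ) →+ Γ) (e : Γ) (P : MvPolynomial σ F) : MvPolynomial σ F :=
  ∑ m ∈ P.support with W m = e, monomial m (coeff m P)

open Classical in
lemma coeff_top (W : (σ →₀ ℕ) →+ Γ) (e : Γ) (P : MvPolynomial σ F) (m : σ →₀ ℕ) :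
    coeff m (top W e P) = if W m = e then coeff m P else 0 := by
  unfold top
  rw [coeff_sum]
  simp only [coeff_monomial]
  rw [Finset.sum_ite_eq']
  by_cases h : W m = e
  · by_cases h2 : coeff m P = 0 <;> simp [h, h2]
  · simp [h]

lemma initial {ι : Type*} (D : Finset ι) (W : (σ →₀ ℕ) →+ Γ) (d : Γ)
    (f M A : ι → MvPolynomial σ F)
    (hM : ∀ j ∈ D, ∀ m, coeff m (M j) ≠ 0 → W m ≤ d)
    (hA1 : ∀ j ∈ D, ∀ m, W m = d → coeff m (A j) = coeff m (M j))
    (hA2 : ∀ j ∈ D, ∀ m, W m ≠ d → coeff m (A j) = 0)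
    (hne : ∃ j ∈ D, f j ≠ 0)
    (hsum : ∑ j ∈ D, f j * M j = 0) :
    ∃ (e : Γ) (g : ι → MvPolynomial σ F), (∃ j ∈ D, g j ≠ 0) ∧ ∑ j ∈ D, g j * A j = 0 ∧
      (∀ j ∈ D, ∀ m ∈ (f j).support, W m ≤ e) ∧
      (∀ j ∈ D, (g j).support ⊆ (f j).support) ∧
      (∀ j ∈ D, ∀ m ∈ (g j).support, W m = e) := by
  classical
  obtain ⟨j0, hj0, hf0⟩ := hne
  have hU : (D.biUnion fun j => (f j).support).Nonempty := by
    obtain ⟨m, hm⟩ := support_nonempty.2 hf0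
    exact ⟨m, mem_biUnion.2 ⟨j0, hj0, hm⟩⟩
  obtain ⟨m1, hm1, hmax⟩ := Finset.exists_max_image _ W hU
  obtain ⟨j1, hj1, hm1⟩ := mem_biUnion.1 hm1
  have hle : ∀ j ∈ D, ∀ m ∈ (f j).support, W m ≤ W m1 := fun j hj m hm =>
    hmax m (mem_biUnion.2 ⟨j, hj, hm⟩)
  refine ⟨W m1, fun j => top W (W m1) (f j), ⟨j1, hj1, ?_⟩, ?_, hle, ?_, ?_⟩
  · intro h
    have := coeff_top W (W m1) (f j1) m1
    simp only at h
    rw [h] at this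
    simp at this
    exact (mem_support_iff.1 hm1) this.symm
  · ext m
    rw [coeff_sum, coeff_zero]
    by_cases hm : W m = W m1 + d
    · rw [← coeff_zero m, ← hsum, coeff_sum]
      refine Finset.sum_congr rfl fun j hj => ?_
      rw [coeff_mul, coeff_mul]
      refine Finset.sum_congr rfl fun xy hxy => ?_
      have hx : xy.1 + xy.2 = m := by simpa using hxy
      have hW : W xy.1 + W xy.2 = W m1 + d := by rw [← map_add, hx, hm]
      rw [coeff_top]
      by_cases h1 : coeff xy.1 (f j) = 0
      · simp [h1]
      have l1 := hle j hj xy.1 (mem_support_iff.2 h1)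
      by_cases h2 : coeff xy.2 (M j) = 0
      · by_cases h3 : W xy.2 = d
        · rw [hA1 j hj _ h3, h2]; simp
        · rw [hA2 j hj _ h3, h2]; simp
      have l2 := hM j hj _ h2
      have e1 : W xy.1 = W m1 := by
        by_contra hc
        exact absurd hW (ne_of_lt (add_lt_add_of_lt_of_le (lt_of_le_of_ne l1 hc) l2))
      have e2 : W xy.2 = d := by
        rw [e1] at hW; exact add_left_cancel hW
      rw [if_pos e1, hA1 j hj _ e2]
    · refine Finset.sum_eq_zero fun j hj => ?_
      rw [coeff_mul]
      refine Finset.sum_eq_zero fun xy hxy => ?_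
      have hx : xy.1 + xy.2 = m := by simpa using hxy
      rw [coeff_top]
      by_cases e1 : W xy.1 = W m1
      · by_cases e2 : W xy.2 = d
        · exact absurd (by rw [← hx, map_add, e1, e2]) hm
        · rw [hA2 j hj _ e2, mul_zero]
      · simp [e1]
  · intro j hj m hm
    rw [mem_support_iff, coeff_top] at hm
    rw [mem_support_iff]
    intro h; simp [h] at hm
  · intro j hj m hm
    rw [mem_support_iff, coeff_top] at hm
    by_contra h; simp [h] at hm

end top

section pm
variable (F : Type*) [Field F] {ι : Type*} [Fintype ι] [DecidableEq ι]

/-- exponent -/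
noncomputable def E (S : Finset ι) (σ : Perm ι) : (ι × ι) →₀ ℕ :=
  ∑ a ∈ S, Finsupp.single (a, σ a) 1

/-- principal minor on index set `S` -/
noncomputable def pm (S : Finset ι) : MvPolynomial (ι × ι) F :=
  ∑ σ : Perm ι with (∀ a, a ∉ S → σ a = a), monomial (E S σ) ((Perm.sign σ : ℤ) : F)

lemma E_apply (S : Finset ι) (σ : Perm ι) (r c : ι) (hr : r ∈ S) :
    E S σ (r, c) = if σ r = c then 1 else 0 := by
  unfold E
  rw [Finsupp.finsetSum_apply, Finset.sum_eq_single r]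
  · simp [Finsupp.single_apply]
  · intro b _ hb; simp [hb]
  · intro h; exact absurd hr h

lemma monomial_E (S : Finset ι) (σ : Perm ι) (c : F) :
    monomial (E S σ) c = C c * ∏ a ∈ S, X (a, σ a) := by
  unfold E
  rw [← mul_one c, ← C_mul_monomial, mul_one]
  congr 1
  rw [monomial_sum_one]
  rfl

lemma det_eq (j : ι) :
    Matrix.det (Matrix.of fun a b : {i : ι // i ≠ j} =>
        (X (a.1, b.1) : MvPolynomial (ι × ι) F)) = pm F (univ.erase j) := by
  rw [← Matrix.det_transpose, Matrix.det_apply']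
  unfold pm
  refine Finset.sum_bij' (fun σ _ => Perm.ofSubtype σ)
    (fun σ hσ => Perm.subtypePerm σ (p := fun i => i ≠ j) (by
      have hj : σ j = j := by simpa using (mem_filter.1 hσ).2 j (by simp)
      intro x
      constructor
      · intro h h2; exact h (by rw [h2, hj])
      · intro h h2; exact h (σ.injective (by rw [h2, hj])))) ?_ ?_ ?_ ?_ ?_
  · intro σ _
    refine mem_filter.2 ⟨mem_univ _, fun a ha => ?_⟩
    exact Perm.ofSubtype_apply_of_not_mem σ (by simpa using ha)
  · intros; exact mem_univ _
  · intro σ _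
    exact Perm.subtypePerm_ofSubtype σ
  · intro σ hσ
    refine Perm.ofSubtype_subtypePerm _ ?_
    intro x hx h2
    exact hx ((mem_filter.1 hσ).2 x (by simp [h2]))
  · intro σ _
    rw [monomial_E, Perm.sign_ofSubtype]
    congr 1
    · rw [Finset.prod_subtype (univ.erase j) (p := fun i => i ≠ j) (by simp)
        (fun a => (X (a, Perm.ofSubtype σ a) : MvPolynomial (ι × ι) F))]
      refine Finset.prod_congr rfl fun a _ => ?_
      simp [Perm.ofSubtype_apply_coe]

/-- terms of the minor through two prescribed entries -/
noncomputable def gs (S : Finset ι) (p q : ι) (ρ : Perm ι) : MvPolynomial (ι × ι) F :=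
  ∑ σ : Perm ι with ((∀ a, a ∉ S → σ a = a) ∧ σ p = ρ p ∧ σ q = ρ q),
    monomial (E S σ) ((Perm.sign σ : ℤ) : F)

lemma gs_eq (S : Finset ι) (p q : ι) (hp : p ∈ S) (hq : q ∈ S) (hpq : p ≠ q) (ρ : Perm ι)
    (hρ : ρ = 1 ∨ ρ = swap p q) :
    gs F S p q ρ = (C ((Perm.sign ρ : ℤ) : F) * (X (p, ρ p) * X (q, ρ q))) *
      pm F ((S.erase p).erase q) := by
  have hfix : ∀ a, a ≠ p → a ≠ q → ρ a = a := by
    intro a h1 h2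
    rcases hρ with rfl | rfl
    · rfl
    · exact swap_apply_of_ne_of_ne h1 h2
  have hinv : ρ * ρ = 1 := by
    rcases hρ with rfl | rfl <;> simp
  have hinv' : ∀ a, ρ (ρ a) = a := fun a => by
    rw [← Perm.mul_apply, hinv]; rfl
  have hcl : ∀ a, (a = p ∨ a = q) → (ρ a = p ∨ ρ a = q) := by
    intro a h
    rcases hρ with rfl | rfl
    · exact h
    · rcases h with rfl | rfl <;> simp
  unfold gs pm
  rw [Finset.mul_sum]
  refine Finset.sum_bij' (fun σ _ => σ * ρ) (fun σ _ => σ * ρ) ?_ ?_ ?_ ?_ ?_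
  · intro σ hσ
    obtain ⟨-, h1, h2, h3⟩ := mem_filter.1 hσ
    have h4 : ∀ a, (a = p ∨ a = q) → σ a = ρ a := by
      rintro a (rfl | rfl) <;> assumption
    refine mem_filter.2 ⟨mem_univ _, fun a ha => ?_⟩
    rw [Perm.mul_apply]
    by_cases hc : a = p ∨ a = q
    · rw [h4 _ (hcl a hc), hinv']
    · push Not at hc
      rw [hfix a hc.1 hc.2]
      apply h1
      intro h; apply ha
      simp [hc.1, hc.2, h]
  · intro σ hσ
    obtain ⟨-, h1⟩ := mem_filter.1 hσ
    have h4 : ∀ a, (a = p ∨ a = q) → σ a = a := by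
      rintro a (rfl | rfl) <;> apply h1 <;> simp
    refine mem_filter.2 ⟨mem_univ _, fun a ha => ?_, ?_, ?_⟩
    · rw [Perm.mul_apply, hfix a (by rintro rfl; exact ha hp) (by rintro rfl; exact ha hq)]
      apply h1; simp [ha]
    · rw [Perm.mul_apply, h4 _ (hcl p (Or.inl rfl))]
    · rw [Perm.mul_apply, h4 _ (hcl q (Or.inr rfl))]
  · intro σ _
    simp only [mul_assoc, hinv, mul_one]
  · intro σ _
    simp only [mul_assoc, hinv, mul_one]
  · intro σ hσ
    obtain ⟨-, h1, h2, h3⟩ := mem_filter.1 hσ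
    rw [monomial_E, monomial_E, Perm.sign_mul]
    rw [← Finset.mul_prod_erase S _ hp, ← Finset.mul_prod_erase (S.erase p) _
      (mem_erase.2 ⟨hpq.symm, hq⟩), h2, h3]
    have : ∏ x ∈ (S.erase p).erase q, (X (x, (σ * ρ) x) : MvPolynomial (ι × ι) F) =
        ∏ x ∈ (S.erase p).erase q, X (x, σ x) := by
      refine Finset.prod_congr rfl fun x hx => ?_
      simp only [mem_erase] at hx
      rw [Perm.mul_apply, hfix x hx.2.1 hx.1]
    rw [this]
    have hs : (C (((Perm.sign ρ : ℤˣ) : ℤ) : F) : MvPolynomial (ι × ι) F) *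
        C (((Perm.sign σ * Perm.sign ρ : ℤˣ) : ℤ) : F) = C (((Perm.sign σ : ℤˣ) : ℤ) : F) := by
      rw [← C_mul]
      congr 1
      rcases Int.units_eq_one_or (Perm.sign ρ) with h | h <;> simp [h]
    rw [← hs]
    ring

variable {F}

lemma coeff_pm_le {Γ : Type*} [AddCommGroup Γ] [LinearOrder Γ] [IsOrderedAddMonoid Γ]
    (S : Finset ι) (p q : ι) (ρ : Perm ι) (W : ((ι × ι) →₀ ℕ) →+ Γ) (d : Γ)
    (h1 : ∀ σ : Perm ι, σ p = ρ p → σ q = ρ q → W (E S σ) = d)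
    (h2 : ∀ σ : Perm ι, ¬ (σ p = ρ p ∧ σ q = ρ q) → W (E S σ) < d) :
    (∀ m, coeff m (pm F S) ≠ 0 → W m ≤ d) ∧
    (∀ m, W m = d → coeff m (gs F S p q ρ) = coeff m (pm F S)) ∧
    (∀ m, W m ≠ d → coeff m (gs F S p q ρ) = 0) := by
  refine ⟨fun m hm => ?_, fun m hm => ?_, fun m hm => ?_⟩
  · unfold pm at hm
    rw [coeff_sum] at hm
    obtain ⟨σ, -, hσ⟩ := Finset.exists_ne_zero_of_sum_ne_zero hm
    rw [coeff_monomial] at hσ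
    have : E S σ = m := by by_contra h; simp [h] at hσ
    rw [← this]
    by_cases h : σ p = ρ p ∧ σ q = ρ q
    · exact (h1 σ h.1 h.2).le
    · exact (h2 σ h).le
  · unfold gs pm
    rw [coeff_sum, coeff_sum, ← Finset.filter_filter, Finset.sum_filter]
    refine Finset.sum_congr rfl fun σ _ => ?_
    split_ifs with h
    · rfl
    · rw [coeff_monomial, if_neg]
      rintro rfl
      exact (h2 σ h).ne hm
  · unfold gs
    rw [coeff_sum]
    refine Finset.sum_eq_zero fun σ hσ => ?_
    obtain ⟨-, -, h3, h4⟩ := mem_filter.1 hσ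
    rw [coeff_monomial, if_neg]
    rintro rfl
    exact hm (h1 σ h3 h4)

lemma peel {Γ : Type*} [AddCommGroup Γ] [LinearOrder Γ] [IsOrderedAddMonoid Γ]
    (D I : Finset ι) (p q : ι) (hp : p ∈ I) (hq : q ∈ I) (hpD : p ∉ D) (hqD : q ∉ D)
    (hpq : p ≠ q) (ρ : Perm ι)
    (hρ : ρ = 1 ∨ ρ = swap p q) (W : ((ι × ι) →₀ ℕ) →+ Γ) (d : Γ)
    (h1 : ∀ S : Finset ι, p ∈ S → q ∈ S →
      ∀ σ : Perm ι, σ p = ρ p → σ q = ρ q → W (E S σ) = d)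
    (h2 : ∀ S : Finset ι, p ∈ S → q ∈ S →
      ∀ σ : Perm ι, ¬ (σ p = ρ p ∧ σ q = ρ q) → W (E S σ) < d)
    (f : ι → MvPolynomial (ι × ι) F)
    (hne : ∃ j ∈ D, f j ≠ 0)
    (hsum : ∑ j ∈ D, f j * pm F (I.erase j) = 0) :
    ∃ (e : Γ) (g : ι → MvPolynomial (ι × ι) F), (∃ j ∈ D, g j ≠ 0) ∧
      ∑ j ∈ D, g j * pm F (((I.erase p).erase q).erase j) = 0 ∧
      (∀ j ∈ D, ∀ m ∈ (f j).support, W m ≤ e) ∧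
      (∀ j ∈ D, (g j).support ⊆ (f j).support) ∧
      (∀ j ∈ D, ∀ m ∈ (g j).support, W m = e) := by
  have hpS : ∀ j ∈ D, p ∈ I.erase j := fun j hj =>
    mem_erase.2 ⟨by rintro rfl; exact hpD hj, hp⟩
  have hqS : ∀ j ∈ D, q ∈ I.erase j := fun j hj =>
    mem_erase.2 ⟨by rintro rfl; exact hqD hj, hq⟩
  have key := fun j (hj : j ∈ D) => coeff_pm_le (F := F) (I.erase j) p q ρ W d
    (h1 _ (hpS j hj) (hqS j hj)) (h2 _ (hpS j hj) (hqS j hj))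
  obtain ⟨e, g, hg, hs, r1, r2, r3⟩ := initial D W d f (fun j => pm F (I.erase j))
    (fun j => gs F (I.erase j) p q ρ) (fun j hj => (key j hj).1) (fun j hj => (key j hj).2.1)
    (fun j hj => (key j hj).2.2) hne hsum
  refine ⟨e, g, hg, ?_, r1, r2, r3⟩
  have hc : (C ((Perm.sign ρ : ℤ) : F) * (X (p, ρ p) * X (q, ρ q)) : MvPolynomial (ι × ι) F)
      ≠ 0 := by
    refine mul_ne_zero ?_ (mul_ne_zero (X_ne_zero _) (X_ne_zero _))
    rw [Ne, C_eq_zero]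
    rcases Int.units_eq_one_or (Perm.sign ρ) with h | h <;> simp [h]
  refine (mul_eq_zero.1 ?_).resolve_left hc
  rw [← hs, Finset.mul_sum]
  refine Finset.sum_congr rfl fun j hj => ?_
  rw [gs_eq F _ p q (hpS j hj) (hqS j hj) hpq ρ hρ]
  have : ((I.erase p).erase q).erase j = ((I.erase j).erase p).erase q := by
    ext; simp; tauto
  rw [this]
  ring

/-- lex weight -/
def W1 (v u : ι × ι) : ((ι × ι) →₀ ℕ) →+ (ℤ ×ₗ ℤ) where
  toFun m := toLex ((m v : ℤ), (m u : ℤ))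
  map_zero' := by simp
  map_add' x y := by simp [← toLex_add]

/-- lex weight -/
def W2 (v u u' : ι × ι) : ((ι × ι) →₀ ℕ) →+ (ℤ ×ₗ ℤ) where
  toFun m := toLex (-(m v : ℤ), (m u : ℤ) + (m u' : ℤ))
  map_zero' := by simp
  map_add' x y := by rw [← toLex_add]; congr 1; ext <;> simp <;> ring

lemma W1_apply (v u : ι × ι) (m) : W1 v u m = toLex ((m v : ℤ), (m u : ℤ)) := rfl

lemma W2_apply (v u u' : ι × ι) (m) :
    W2 v u u' m = toLex (-(m v : ℤ), (m u : ℤ) + (m u' : ℤ)) := rfl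

lemma double (D I : Finset ι) (p q : ι) (hp : p ∈ I) (hq : q ∈ I) (hpD : p ∉ D) (hqD : q ∉ D)
    (hpq : p ≠ q) (ρ : Perm ι) (hρ : ρ = 1 ∨ ρ = swap p q) 
    (f : ι → MvPolynomial (ι × ι) F)
    (hne : ∃ j ∈ D, f j ≠ 0)
    (hsum : ∑ j ∈ D, f j * pm F (I.erase j) = 0)
    (j1 j2 : ι) (hj1 : j1 ∈ D) (hj2 : j2 ∈ D) (m1 m2 : (ι × ι) →₀ ℕ)
    (hm1 : m1 ∈ (f j1).support) (hm2 : m2 ∈ (f j2).support)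
    (hlt : m1 (p, ρ p) < m2 (p, ρ p)) :
    ∃ g h : ι → MvPolynomial (ι × ι) F, (∃ j ∈ D, g j ≠ 0) ∧ (∃ j ∈ D, h j ≠ 0) ∧
      ∑ j ∈ D, g j * pm F (((I.erase p).erase q).erase j) = 0 ∧
      ∑ j ∈ D, h j * pm F (((I.erase p).erase q).erase j) = 0 ∧
      ∑ j ∈ D, (g j).support.card + ∑ j ∈ D, (h j).support.card ≤ ∑ j ∈ D, (f j).support.card
      := by
  have hne' : ρ p ≠ ρ q := fun h => hpq (ρ.injective h)
  obtain ⟨e, g, hg, gs, g1, g2, g3⟩ := peel D I p q hp hq hpD hqD hpq ρ hρ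
    (W1 (p, ρ p) (q, ρ q)) (toLex (1, 1)) (by
      intro S hpS hqS σ h1 h2
      simp [W1_apply, E_apply, hpS, hqS, h1, h2]) (by
      intro S hpS hqS σ h
      simp only [W1_apply, E_apply S σ _ _ hpS,
        E_apply S σ _ _ hqS, Prod.Lex.toLex_lt_toLex]
      split_ifs <;> simp_all) f hne hsum
  have hρ' : ρ * swap p q = 1 ∨ ρ * swap p q = swap p q := by
    rcases hρ with rfl | rfl <;> simp
  obtain ⟨e', h, hh, hs, h1, h2, h3⟩ := peel D I p q hp hq hpD hqD hpq (ρ * swap p q) hρ'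
    (W2 (p, ρ p) (p, ρ q) (q, ρ p)) (toLex (0, 2)) (by
      intro S hpS hqS σ h1 h2
      simp only [Perm.mul_apply, swap_apply_left, swap_apply_right] at h1 h2
      simp [W2_apply, E_apply, hpS, hqS, h1, h2, hne'.symm]) (by
      intro S hpS hqS σ h
      simp only [Perm.mul_apply, swap_apply_left, swap_apply_right] at h
      simp only [W2_apply, E_apply S σ _ _ hpS,
        E_apply S σ _ _ hqS, Prod.Lex.toLex_lt_toLex]
      split_ifs <;> simp_all) f hne hsum
  refine ⟨g, h, hg, hh, gs, hs, ?_⟩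
  rw [← Finset.sum_add_distrib]
  refine Finset.sum_le_sum fun j hj => ?_
  rw [← Finset.card_union_of_disjoint]
  · exact Finset.card_le_card (Finset.union_subset (g2 j hj) (h2 j hj))
  rw [Finset.disjoint_left]
  intro m hmg hmh
  have a1 := g1 j2 hj2 m2 hm2
  rw [← g3 j hj m hmg] at a1
  have a2 := h1 j1 hj1 m1 hm1
  rw [← h3 j hj m hmh] at a2
  simp only [W1_apply, W2_apply, Prod.Lex.toLex_le_toLex] at a1 a2
  rcases a1 with a1 | a1 <;> rcases a2 with a2 | a2 <;> omega

lemma exists_inv (D C : Finset ι) (hd : Disjoint D C) (hc : D.card ≤ C.card) :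
    ∃ π : ι → ι, Function.Involutive π ∧ (∀ a ∈ D, π a ∈ C) ∧
      (∀ a, a ∉ D → a ∉ C → π a = a) ∧ (∀ a ∈ C, π a ∈ D ∨ π a = a) := by
  obtain ⟨C', hC', hcard⟩ := Finset.exists_subset_card_eq hc
  let e : D ≃ C' := Finset.equivOfCardEq hcard.symm
  have hdis : ∀ a, a ∈ C' → a ∉ D := fun a h1 h2 => (Finset.disjoint_left.1 hd) h2 (hC' h1)
  let π : ι → ι := fun a => if h : a ∈ D then (e ⟨a, h⟩ : ι) else
    if h : a ∈ C' then (e.symm ⟨a, h⟩ : ι) else a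
  have p1 : ∀ a (h : a ∈ D), π a = e ⟨a, h⟩ := fun a h => by simp [π, h]
  have p2 : ∀ a (h : a ∈ C'), π a = e.symm ⟨a, h⟩ := fun a h => by simp [π, h, hdis a h]
  have p3 : ∀ a, a ∉ D → a ∉ C' → π a = a := fun a h h' => by simp [π, h, h']
  refine ⟨π, fun a => ?_, fun a ha => ?_, fun a h1 h2 => p3 a h1 fun h => h2 (hC' h),
    fun a ha => ?_⟩
  · by_cases h : a ∈ D
    · rw [p1 a h, p2 _ (e ⟨a, h⟩).2]; simp
    by_cases h' : a ∈ C'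
    · rw [p2 a h', p1 _ (e.symm ⟨a, h'⟩).2]; simp
    · rw [p3 a h h', p3 a h h']
  · rw [p1 a ha]; exact hC' (e ⟨a, ha⟩).2
  · by_cases h' : a ∈ C'
    · left; rw [p2 a h']; exact (e.symm ⟨a, h'⟩).2
    · right; exact p3 a (fun h => Finset.disjoint_left.1 hd h ha) h'

lemma eval_pm (S : Finset ι) (P : ι × ι → F) :
    eval P (pm F S) = ∑ σ : Perm ι with (∀ a, a ∉ S → σ a = a),
      ((Perm.sign σ : ℤ) : F) * ∏ a ∈ S, P (a, σ a) := by
  unfold pm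
  rw [map_sum]
  refine Finset.sum_congr rfl fun σ _ => ?_
  rw [monomial_E]
  simp

/-- the test matrices -/
def Pk (F : Type*) [Field F] (π : ι → ι) (k : ι) (v : ι × ι) : F :=
  if v.2 = π v.1 ∨ (v.1 = π k ∧ v.2 = π k) then 1 else 0

lemma eval_diff (D I : Finset ι) (hDI : D ⊆ I) (π : ι → ι) (hπ : Function.Involutive π)
    (h1 : ∀ a ∈ D, π a ∈ I \ D) (j k : ι) (hj : j ∈ D) (hjk : j ≠ k) :
    eval (Pk F π k) (pm F (I.erase j)) = 0 := by
  rw [eval_pm]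
  refine Finset.sum_eq_zero fun σ hσ => ?_
  have hσj : σ j = j := (mem_filter.1 hσ).2 j (by simp)
  have hπj := mem_sdiff.1 (h1 j hj)
  have hne : π j ≠ j := fun h => hπj.2 (by rw [h]; exact hj)
  rw [Finset.prod_eq_zero (i := π j) (mem_erase.2 ⟨hne, hπj.1⟩), mul_zero]
  unfold Pk
  rw [if_neg]
  rintro (h | ⟨h, -⟩)
  · simp only [hπ j] at h
    exact hne (σ.injective (h.trans hσj.symm))
  · exact hjk (hπ.injective h)

lemma eval_same (D I : Finset ι) (hDI : D ⊆ I) (π : ι → ι) (hπ : Function.Involutive π)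
    (h1 : ∀ a ∈ D, π a ∈ I \ D) (h2 : ∀ a, a ∉ I → π a = a) (k : ι) (hk : k ∈ D) :
    eval (Pk F π k) (pm F (I.erase k)) ≠ 0 := by
  rw [eval_pm]
  have hπk := mem_sdiff.1 (h1 k hk)
  have hne : π k ≠ k := fun h => hπk.2 (by rw [h]; exact hk)
  let τ : Perm ι := hπ.toPerm * swap k (π k)
  have t1 : τ k = k := by simp [τ, hπ k]
  have t2 : τ (π k) = π k := by simp [τ]
  have t3 : ∀ a, a ≠ k → a ≠ π k → τ a = π a := fun a h h' => by
    simp [τ, swap_apply_of_ne_of_ne h h']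
  have tout : ∀ a, a ∉ I.erase k → τ a = a := by
    intro a ha
    by_cases hak : a = k
    · rw [hak, t1]
    · have : a ∉ I := fun h => ha (mem_erase.2 ⟨hak, h⟩)
      rw [t3 a hak (by rintro rfl; exact this hπk.1), h2 a this]
  rw [Finset.sum_eq_single τ]
  · rw [Finset.prod_eq_one, mul_one]
    · rcases Int.units_eq_one_or (Perm.sign τ) with h | h <;> simp [h]
    · intro a ha
      have ha := mem_erase.1 ha
      unfold Pk
      rw [if_pos]
      by_cases h : a = π k
      · right; simp [h, t2]
      · left; exact t3 a ha.1 h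
  · intro σ hσ hστ
    have hσ' := (mem_filter.1 hσ).2
    have hσk : σ k = k := hσ' k (by simp)
    have : ∃ a ∈ I.erase k, σ a ≠ τ a := by
      by_contra! hc
      apply hστ
      ext a
      by_cases ha : a ∈ I.erase k
      · exact hc a ha
      · rw [hσ' a ha, tout a ha]
    obtain ⟨a, ha, hne'⟩ := this
    rw [Finset.prod_eq_zero ha, mul_zero]
    unfold Pk
    rw [if_neg]
    have ha := (mem_erase.1 ha).1
    rintro (h | ⟨h, h'⟩)
    · simp only at h
      by_cases hak : a = π k
      · rw [hak, hπ k] at h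
        exact hne (σ.injective (h.trans hσk.symm))
      · rw [t3 a ha hak] at hne'; exact hne' h
    · simp only at h h'
      rw [h', h, t2] at hne'
      exact hne' rfl
  · intro h
    exact absurd (mem_filter.2 ⟨mem_univ _, tout⟩) h

lemma base (D I : Finset ι) (hDI : D ⊆ I) (hcard : D.card ≤ (I \ D).card)
    (f : ι → MvPolynomial (ι × ι) F)
    (hne : ∃ j ∈ D, f j ≠ 0)
    (hsum : ∑ j ∈ D, f j * pm F (I.erase j) = 0)
    (hconst : ∀ j1 ∈ D, ∀ j2 ∈ D, ∀ m1 ∈ (f j1).support, ∀ m2 ∈ (f j2).support,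
      ∀ a ∈ I \ D, ∀ b ∈ I \ D, m1 (a, b) = m2 (a, b)) : False := by
  obtain ⟨j0, hj0, hf0⟩ := hne
  obtain ⟨m0, hm0⟩ := support_nonempty.2 hf0
  obtain ⟨π, hπ, h1, h2, h3⟩ := exists_inv D (I \ D) disjoint_sdiff hcard
  have h2' : ∀ a, a ∉ I → π a = a := fun a ha => h2 a (fun h => ha (hDI h)) (by simp [ha])
  let Q : ι × ι → Prop := fun v => v.1 ∈ I \ D ∧ v.2 ∈ I \ D
  classical
  let α := m0.filter Q
  let g := fun j => divMonomial (f j) α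
  have hfg : ∀ j ∈ D, f j = monomial α 1 * g j := by
    intro j hj
    ext m
    rw [coeff_monomial_mul', one_mul]
    split_ifs with h
    · rw [coeff_divMonomial, add_tsub_cancel_of_le h]
    · by_contra hc
      apply h
      intro v
      by_cases hv : Q v
      · rw [Finsupp.filter_apply_pos _ _ hv]
        exact (hconst j0 hj0 j hj m0 hm0 m (mem_support_iff.2 hc) v.1 hv.1 v.2 hv.2).le
      · rw [Finsupp.filter_apply_neg _ _ hv]; exact Nat.zero_le _
  have hgv : ∀ j ∈ D, ∀ m, coeff m (g j) ≠ 0 → ∀ v, Q v → m v = 0 := by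
    intro j hj m hm v hv
    rw [coeff_divMonomial] at hm
    have := hconst j0 hj0 j hj m0 hm0 _ (mem_support_iff.2 hm) v.1 hv.1 v.2 hv.2
    rw [Finsupp.add_apply, Finsupp.filter_apply_pos _ _ hv] at this
    simpa using this
  have hgsum : ∑ j ∈ D, g j * pm F (I.erase j) = 0 := by
    have hmon : (monomial α (1 : F)) ≠ 0 := by simp
    refine (mul_eq_zero.1 ?_).resolve_left hmon
    rw [← hsum, Finset.mul_sum]
    refine Finset.sum_congr rfl fun j hj => ?_
    rw [hfg j hj]; ring
  let φ : ι → MvPolynomial (ι × ι) F →ₐ[F] MvPolynomial (ι × ι) F := fun k =>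
    aeval (fun v => if Q v then C (Pk F π k v) else X v)
  have hφ : ∀ k, ∀ j ∈ D, φ k (g j) = g j := by
    intro k j hj
    conv_rhs => rw [← aeval_X_left_apply (g j)]
    simp only [φ, aeval_def]
    refine eval₂Hom_congr' rfl ?_ rfl
    intro v hv _
    obtain ⟨m, hm, hmv⟩ := (mem_vars v).1 hv
    have : ¬ Q v := fun hq => (Finsupp.mem_support_iff.1 hmv)
      (hgv j hj m (mem_support_iff.1 hm) v hq)
    simp [this]
  let N : Matrix D D (MvPolynomial (ι × ι) F) := Matrix.of fun k j => φ k (pm F (I.erase j))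
  have hN : N.mulVec (fun j => g j) = 0 := by
    ext1 k
    have := congrArg (φ k) hgsum
    rw [map_sum, map_zero, ← Finset.sum_attach] at this
    rw [Pi.zero_apply, ← this]
    simp only [Matrix.mulVec, dotProduct, N, Matrix.of_apply]
    refine Finset.sum_congr rfl fun j _ => ?_
    rw [map_mul, hφ k j j.2, mul_comm]
  have hdet : N.det ≠ 0 := by
    intro h0
    let P : ι × ι → F := fun v => if v.2 = π v.1 then 1 else 0
    have hcomp : ∀ k ∈ D, ∀ x, eval P (φ k x) = eval (Pk F π k) x := by
      intro k hk x
      have : ((aeval P : MvPolynomial (ι × ι) F →ₐ[F] F).comp (φ k)) = aeval (Pk F π k) := by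
        refine algHom_ext fun v => ?_
        simp only [φ, AlgHom.comp_apply, aeval_X]
        by_cases hv : Q v
        · simp [hv]
        · rw [if_neg hv, aeval_X]
          have : ¬ (v.1 = π k ∧ v.2 = π k) := by
            rintro ⟨ha, hb⟩
            exact hv ⟨ha ▸ h1 k hk, hb ▸ h1 k hk⟩
          simp [P, Pk, this]
      have := DFunLike.congr_fun this x
      simpa [aeval_eq_eval] using this
    have := congrArg (eval P) h0
    rw [map_zero, RingHom.map_det] at this
    have hd : (eval P).mapMatrix N =
        Matrix.diagonal (fun k : D => eval (Pk F π k) (pm F (I.erase k))) := by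
      ext k j
      simp only [RingHom.mapMatrix_apply, Matrix.map_apply, N, Matrix.of_apply]
      rw [hcomp k k.2, Matrix.diagonal_apply]
      split_ifs with h
      · rw [h]
      · exact eval_diff D I hDI π hπ h1 j k j.2 (fun hh => h (Subtype.ext hh.symm))
    rw [hd, Matrix.det_diagonal, Finset.prod_eq_zero_iff] at this
    obtain ⟨k, -, hk⟩ := this
    exact eval_same D I hDI π hπ h1 h2' k k.2 hk
  have := congrFun (Matrix.eq_zero_of_mulVec_eq_zero hdet hN) ⟨j0, hj0⟩
  apply hf0
  rw [hfg j0 hj0]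
  simp only [Pi.zero_apply] at this
  rw [this, mul_zero]

lemma main (c : ℕ) : ∀ (D I : Finset ι), I.card = c → D ⊆ I →
    ∀ (f : ι → MvPolynomial (ι × ι) F), (∃ j ∈ D, f j ≠ 0) →
    ∑ j ∈ D, f j * pm F (I.erase j) = 0 →
    (2 : ℝ) ^ ((c : ℝ) / 2 - D.card) ≤ ((∑ j ∈ D, (f j).support.card : ℕ) : ℝ) := by
  induction c using Nat.strong_induction_on with
  | _ c ih =>
  intro D I hI hDI f hne hsum
  obtain ⟨j0, hj0, hf0⟩ := hne
  by_cases hsmall : c ≤ 2 * D.card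
  · have e1 : (2 : ℝ) ^ ((c : ℝ) / 2 - D.card) ≤ 1 := by
      apply Real.rpow_le_one_of_one_le_of_nonpos (by norm_num)
      have : (c : ℝ) ≤ 2 * D.card := by exact_mod_cast hsmall
      linarith
    refine e1.trans ?_
    have : 1 ≤ ∑ j ∈ D, (f j).support.card :=
      (Finset.card_pos.2 (support_nonempty.2 hf0)).trans_le
        (Finset.single_le_sum (f := fun j => (f j).support.card) (fun _ _ => Nat.zero_le _) hj0)
    exact_mod_cast this
  have hDpos : 0 < D.card := Finset.card_pos.2 ⟨j0, hj0⟩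
  have hcd : (I \ D).card = c - D.card := by rw [Finset.card_sdiff_of_subset hDI, hI]
  have key : ∃ j1 ∈ D, ∃ j2 ∈ D, ∃ m1 ∈ (f j1).support, ∃ m2 ∈ (f j2).support,
      ∃ a ∈ I \ D, ∃ b ∈ I \ D, m1 (a, b) < m2 (a, b) := by
    by_contra! hc
    refine base D I hDI (by omega) f ⟨j0, hj0, hf0⟩ hsum ?_
    intro j1 hj1 j2 hj2 m1 hm1 m2 hm2 a ha b hb
    exact le_antisymm (hc j2 hj2 j1 hj1 m2 hm2 m1 hm1 a ha b hb)
      (hc j1 hj1 j2 hj2 m1 hm1 m2 hm2 a ha b hb)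
  obtain ⟨j1, hj1, j2, hj2, m1, hm1, m2, hm2, a, ha, b, hb, hlt⟩ := key
  have hpq : ∃ q ∈ I \ D, a ≠ q ∧ ∃ ρ : Perm ι, (ρ = 1 ∨ ρ = swap a q) ∧ ρ a = b := by
    by_cases hab : a = b
    · obtain ⟨q, hq, hqa⟩ := Finset.exists_mem_ne (s := I \ D) (by omega) a
      exact ⟨q, hq, hqa.symm, 1, Or.inl rfl, hab⟩
    · exact ⟨b, hb, hab, swap a b, Or.inr rfl, by simp⟩
  obtain ⟨q, hq, haq, ρ, hρ, rfl⟩ := hpq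
  rw [mem_sdiff] at ha hq
  obtain ⟨g, h, hg, hh, gs, hs, hle⟩ := double D I a q ha.1 hq.1 ha.2 hq.2 haq ρ hρ f
    ⟨j0, hj0, hf0⟩ hsum j1 j2 hj1 hj2 m1 m2 hm1 hm2 hlt
  have hc' : ((I.erase a).erase q).card = c - 2 := by
    rw [Finset.card_erase_of_mem (mem_erase.2 ⟨haq.symm, hq.1⟩), Finset.card_erase_of_mem ha.1, hI]
    omega
  have hsub : D ⊆ (I.erase a).erase q := by
    intro x hx
    refine mem_erase.2 ⟨?_, mem_erase.2 ⟨?_, hDI hx⟩⟩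
    · rintro rfl; exact hq.2 hx
    · rintro rfl; exact ha.2 hx
  have i1 := ih (c - 2) (by omega) D _ hc' hsub g hg gs
  have i2 := ih (c - 2) (by omega) D _ hc' hsub h hh hs
  have hle' : ((∑ j ∈ D, (g j).support.card : ℕ) : ℝ) + ((∑ j ∈ D, (h j).support.card : ℕ) : ℝ)
      ≤ ((∑ j ∈ D, (f j).support.card : ℕ) : ℝ) := by exact_mod_cast hle
  have hpow : (2 : ℝ) ^ ((c : ℝ) / 2 - D.card) = 2 * 2 ^ (((c - 2 : ℕ) : ℝ) / 2 - D.card) := by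
    rw [Nat.cast_sub (by omega)]
    rw [show (c : ℝ) / 2 - D.card = 1 + (((c : ℝ) - (2 : ℕ)) / 2 - D.card) by push_cast; ring,
      Real.rpow_add (by norm_num), Real.rpow_one]
  rw [hpow]
  linarith

end pm
end S8

theorem statement8 {F : Type*} [Field F] [CharZero F] {n t : ℕ}
    (D : Finset (Fin n)) (hD : D.card = t)
    (f : Fin n → MvPolynomial (Fin n × Fin n) F)
    (hne : ∃ j ∈ D, f j ≠ 0)
    (hsum : ∑ j ∈ D, f j *
      Matrix.det (Matrix.of fun a b : {i : Fin n // i ≠ j} =>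
        (X (a.1, b.1) : MvPolynomial (Fin n × Fin n) F)) = 0) :
    (2 : ℝ) ^ ((n : ℝ) / 2 - t) ≤ ∑ j ∈ D, ((f j).support.card : ℝ) := by
  subst hD
  simp only [S8.det_eq] at hsum
  have := S8.main n D Finset.univ (by simp) (Finset.subset_univ _) f hne hsum
  push_cast at this
  exact this
end

section
/- Let F be a field of characteristic zero, let M = (x_{ij}) be the n×n matrix of distinct indeterminates, and let M_1, …, M_t (t ≥ 1) be the first-order principal minors of M with respect to t distinct diagonal indices. Let ℓ_1, …, ℓ_k ∈ F[x_{11}, …, x_{nn}] be polynomials of total degree at most 1 whose homogeneous degree-1 parts are F-linearly independent. If there exist α_1, …, α_t ∈ F, not all zero, such that Σ_{i=1}^{t} α_i · M_i lies in the ideal generated by ℓ_1, …, ℓ_k, then t + k ≥ n. -/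
open MvPolynomial

theorem exists_li_add {F : Type*} [Field F] [Infinite F] {m : ℕ} {V : Type*} [AddCommGroup V]
    [Module F V] [FiniteDimensional F V] (hV : Module.finrank F V = m) (x y : Fin m → V)
    (hy : LinearIndependent F y) : ∃ s : F, LinearIndependent F (fun i => x i + s • y i) := by
  classical
  have : Fintype.card (Fin m) = Module.finrank F V := by simp [hV]
  let b := basisOfLinearIndependentOfCardEqFinrank' y hy this
  have hb : ∀ i, b i = y i := by intro i; simp [b]
  let A : Matrix (Fin m) (Fin m) F := b.toMatrix x
  obtain ⟨s, hs⟩ := Infinite.exists_notMem_finset (-A).charpoly.roots.toFinset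
  refine ⟨s, ?_⟩
  have h0 : ((-A).charpoly).eval s ≠ 0 := by
    intro h
    apply hs
    simp [Matrix.charpoly_monic _ |>.ne_zero, h]
  rw [Matrix.eval_charpoly] at h0
  have h1 : b.toMatrix (fun i => x i + s • y i) = Matrix.scalar (Fin m) s - (-A) := by
    ext i j
    simp only [Module.Basis.toMatrix_apply, map_add, map_smul, ← hb, A, sub_neg_eq_add, Matrix.add_apply, Matrix.scalar_apply, Finsupp.add_apply, Finsupp.smul_apply, Module.Basis.repr_self, Matrix.diagonal_apply, Finsupp.single_apply, smul_eq_mul]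
    rw [add_comm]
    congr 1
    simp [eq_comm]
  have h2 : IsUnit (b.det (fun i => x i + s • y i)) := by
    rw [Module.Basis.det_apply, h1]; exact isUnit_iff_ne_zero.2 h0
  exact ((Module.Basis.is_basis_iff_det b).2 h2).1

theorem exists_li {F : Type*} [Field F] [Infinite F] (m : ℕ) : ∀ {V : Type*} [AddCommGroup V]
    [Module F V] [FiniteDimensional F V] (_ : Module.finrank F V = m) (W : Submodule F (Fin m → V))
    (_ : m * m ≤ Module.finrank F W + (m - 1)), ∃ w ∈ W, LinearIndependent F w := by
  induction m with
  | zero => intro V _ _ _ _ W _; exact ⟨0, W.zero_mem, linearIndependent_empty_type⟩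
  | succ m ih =>
    intro V _ _ _ hV W hW
    let T : (Fin (m+1) → V) →ₗ[F] (Fin m → V) := LinearMap.pi fun i => LinearMap.proj i.succ
    let Z : (Fin m → V) →ₗ[F] (Fin (m+1) → V) :=
      LinearMap.pi fun i => Fin.cases 0 (fun j => LinearMap.proj j) i
    have hZ0 : ∀ x, Z x 0 = 0 := fun x => rfl
    have hZs : ∀ x (i : Fin m), Z x i.succ = x i := fun x i => rfl
    let W1 := W.comap Z
    let p : W →ₗ[F] V := (LinearMap.proj 0).comp W.subtype
    have hrn := p.finrank_range_add_finrank_ker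
    have hker : Module.finrank F p.ker ≤ Module.finrank F W1 := by
      have key : ∀ u : p.ker, Z (T (u : W).1) = (u : W).1 := by
        intro u
        funext i
        refine Fin.cases ?_ (fun j => ?_) i
        · exact (u.2 : p u.1 = 0).symm
        · rfl
      let g : p.ker →ₗ[F] W1 := ((T.comp W.subtype).comp p.ker.subtype).codRestrict W1 (by
        intro u
        change Z (T (u : W).1) ∈ W
        rw [key]; exact u.1.2)
      apply LinearMap.finrank_le_finrank_of_injective (f := g)
      intro u v huv
      have : T (u : W).1 = T (v : W).1 := congrArg Subtype.val huv
      apply Subtype.ext; apply Subtype.ext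
      rw [← key u, ← key v, this]
    have hp : Module.finrank F p.range ≤ m + 1 := (Submodule.finrank_le _).trans hV.le
    have hW1 : Module.finrank F W1 ≤ m * (m + 1) := by
      have := Submodule.finrank_le W1
      rwa [Module.finrank_pi_fintype, Finset.sum_const, hV, Finset.card_univ, Fintype.card_fin, smul_eq_mul] at this
    -- choose c
    have hc : ∃ c ∈ p.range, c ≠ 0 ∧ (m = 0 ∨ m * m + 1 ≤ Module.finrank F W1 ∨
        ∃ x : Fin m → V, (∀ i, x i ∈ F ∙ c) ∧ x ∉ W1) := by
      by_cases h : m = 0 ∨ m * m + 1 ≤ Module.finrank F W1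
      · have : p.range ≠ ⊥ := by
          intro hb
          rw [hb, finrank_bot] at hrn
          simp only [Nat.add_sub_cancel] at hW
          nlinarith
        obtain ⟨c, hc, hc0⟩ := Submodule.exists_mem_ne_zero_of_ne_bot this
        exact ⟨c, hc, hc0, by tauto⟩
      · push Not at h
        have htop : p.range = ⊤ := by
          apply Submodule.eq_top_of_finrank_eq
          rw [hV]
          simp only [Nat.add_sub_cancel] at hW
          nlinarith
        have hne : W1 ≠ ⊤ := by
          intro h1
          have h2 := h.2
          rw [h1, finrank_top, Module.finrank_pi_fintype, Finset.sum_const, hV, Finset.card_univ, Fintype.card_fin, smul_eq_mul] at h2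
          have := h.1
          have : 1 ≤ m := by omega
          nlinarith
        have : ∃ (i : Fin m) (v : V), Pi.single i v ∉ W1 := by
          by_contra! hcon
          apply hne
          rw [eq_top_iff]
          intro x _
          rw [← Finset.univ_sum_single x]
          exact Submodule.sum_mem _ fun i _ => hcon i _
        obtain ⟨i, v, hv⟩ := this
        refine ⟨v, htop ▸ Submodule.mem_top, ?_, Or.inr (Or.inr ⟨Pi.single i v, ?_, hv⟩)⟩
        · rintro rfl
          simp at hv
        · intro j
          by_cases hj : j = i
          · subst hj; simp
          · simp [hj]
    obtain ⟨c, ⟨w0, hw0⟩, hc0, hc⟩ := hc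
    have hQ : Module.finrank F (V ⧸ (F ∙ c)) = m := by
      have := Submodule.finrank_quotient_add_finrank (F ∙ c)
      rw [finrank_span_singleton hc0, hV] at this
      omega
    let q : (Fin m → V) →ₗ[F] (Fin m → V ⧸ (F ∙ c)) := (F ∙ c).mkQ.compLeft (Fin m)
    have hqs : Function.Surjective q := by
      intro y
      choose x hx using fun i => Submodule.mkQ_surjective (F ∙ c) (y i)
      exact ⟨x, funext hx⟩
    have hkq : Module.finrank F q.ker = m := by
      have := q.finrank_range_add_finrank_ker
      rw [LinearMap.range_eq_top.2 hqs, finrank_top, Module.finrank_pi_fintype, Module.finrank_pi_fintype, Finset.sum_const, Finset.sum_const, hV, hQ, Finset.card_univ, Fintype.card_fin, smul_eq_mul, smul_eq_mul] at this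
      nlinarith
    have hmap : Module.finrank F (W1.map q) + Module.finrank F (W1 ⊓ q.ker : Submodule F (Fin m → V)) = Module.finrank F W1 := by
      have := (q.domRestrict W1).finrank_range_add_finrank_ker
      rw [LinearMap.range_domRestrict, LinearMap.ker_domRestrict] at this
      rw [← this]
      congr 1
      rw [LinearEquiv.finrank_eq (Submodule.equivMapOfInjective W1.subtype (Submodule.injective_subtype _) (Submodule.comap W1.subtype q.ker)), Submodule.map_comap_subtype]
    have hle : Module.finrank F (W1 ⊓ q.ker : Submodule F (Fin m → V)) ≤ m :=
      (Submodule.finrank_mono inf_le_right).trans hkq.le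
    obtain ⟨y, hy, hyl⟩ := ih hQ (W1.map q) (by
      simp only [Nat.add_sub_cancel] at hW
      rcases hc with hc | hc | ⟨x, hx, hxW⟩
      · subst hc; simp
      · have : 1 ≤ m ∨ m = 0 := by omega
        rcases this with h | h
        · zify [h] at *; linarith
        · subst h; simp
      · have hlt : Module.finrank F (W1 ⊓ q.ker : Submodule F (Fin m → V)) < m := by
          conv_rhs => rw [← hkq]
          apply Submodule.finrank_lt_finrank_of_lt
          refine lt_of_le_of_ne inf_le_right fun h => hxW ?_
          have : x ∈ q.ker := by
            rw [LinearMap.mem_ker]; funext i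
            exact (Submodule.Quotient.mk_eq_zero _).2 (hx i)
          rw [← h] at this
          exact this.1
        have h : 1 ≤ m := by omega
        zify [h] at *; linarith)
    obtain ⟨w1, hw1, rfl⟩ := hy
    obtain ⟨s, hs⟩ := exists_li_add hQ (q (T w0.1)) (q w1) hyl
    refine ⟨w0.1 + s • Z w1, W.add_mem w0.2 (W.smul_mem _ hw1), ?_⟩
    rw [Fintype.linearIndependent_iff] at hs ⊢
    intro g hg
    have hw00 : w0.1 0 = c := hw0
    rw [Fin.sum_univ_succ] at hg
    have hz : (w0.1 + s • Z w1) 0 = c := by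
      simp [hZ0, hw00]
    rw [hz] at hg
    have hgs : ∀ i : Fin m, g i.succ = 0 := by
      apply hs (fun i => g i.succ)
      have := congrArg (F ∙ c).mkQ hg
      rw [map_add, map_sum, map_smul, map_zero] at this
      have hc' : (F ∙ c).mkQ c = 0 := (Submodule.Quotient.mk_eq_zero _).2 (Submodule.mem_span_singleton_self c)
      rw [hc', smul_zero, zero_add] at this
      rw [← this]
      apply Finset.sum_congr rfl
      intro i _
      rw [map_smul, Pi.add_apply, map_add, Pi.smul_apply, map_smul]
      rfl
    have hg0 : g 0 = 0 := by
      simp only [hgs, zero_smul, Finset.sum_const_zero, add_zero] at hg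
      exact (smul_eq_zero.1 hg).resolve_right hc0
    exact fun i => Fin.cases hg0 hgs i

theorem hom_one {F σ : Type*} [Field F] [Fintype σ] (f : MvPolynomial σ F) :
    homogeneousComponent 1 f = ∑ p, C (coeff (Finsupp.single p 1) f) * X p := by
  classical
  ext d
  rw [coeff_homogeneousComponent, coeff_sum]
  simp only [coeff_C_mul, coeff_X]
  split_ifs with h
  · obtain ⟨p, rfl⟩ : ∃ p, d = Finsupp.single p 1 := by
      rw [Finsupp.degree_eq_sum] at h
      exact (Finsupp.sum_eq_one_iff d).1 (by rw [Finsupp.sum_fintype _ _ (by simp)]; exact h)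
    simp [Finsupp.single_left_inj]
  · symm
    apply Finset.sum_eq_zero
    intro p _
    rw [if_neg, mul_zero]
    rintro rfl
    simp at h

theorem eval_deg_le_one {F σ : Type*} [Field F] [Fintype σ] (f : MvPolynomial σ F)
    (hf : f.totalDegree ≤ 1) (v : σ → F) :
    eval v f = coeff 0 f + ∑ p, coeff (Finsupp.single p 1) f * v p := by
  have h : f = homogeneousComponent 0 f + homogeneousComponent 1 f := by
    conv_lhs => rw [← sum_homogeneousComponent f]
    rw [Finset.sum_subset (s₂ := Finset.range 2), Finset.sum_range_succ, Finset.sum_range_one]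
    · intro i hi; simp at hi ⊢; omega
    · intro i _ hi
      apply homogeneousComponent_eq_zero
      simp at hi; omega
  conv_lhs => rw [h, hom_one, homogeneousComponent_zero]
  simp

theorem statement9 {F : Type*} [Field F] [CharZero F] {n t k : ℕ} (ht : 1 ≤ t)
    (D : Finset (Fin n)) (hD : D.card = t)
    (ℓ : Fin k → MvPolynomial (Fin n × Fin n) F)
    (hlin : ∀ i, (ℓ i).totalDegree ≤ 1)
    (hindep : LinearIndependent F fun i => (homogeneousComponent 1) (ℓ i))
    (α : Fin n → F) (hα : ∃ j ∈ D, α j ≠ 0)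
    (hmem : ∑ j ∈ D, MvPolynomial.C (α j) *
        Matrix.det (Matrix.of fun a b : {i : Fin n // i ≠ j} =>
          (X (a.1, b.1) : MvPolynomial (Fin n × Fin n) F)) ∈
      Ideal.span (Set.range ℓ)) :
    n ≤ t + k := by
  by_contra hcon
  push Not at hcon
  obtain ⟨j0, hj0, hα0⟩ := hα
  let L : Matrix (Fin k) (Fin n × Fin n) F := Matrix.of fun i p => coeff (Finsupp.single p 1) (ℓ i)
  have hev : ∀ i x, eval x (ℓ i) = coeff 0 (ℓ i) + (L.mulVec x) i := fun i x =>
    eval_deg_le_one (ℓ i) (hlin i) x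
  have hL : LinearIndependent F L.row := by
    rw [Fintype.linearIndependent_iff] at hindep ⊢
    intro g hg
    apply hindep g
    simp only [hom_one, Finset.smul_sum]
    rw [Finset.sum_comm]
    apply Finset.sum_eq_zero
    intro p _
    have := congrFun hg p
    simp only [Finset.sum_apply, Pi.smul_apply, smul_eq_mul, Pi.zero_apply] at this
    simp only [smul_eq_C_mul, ← mul_assoc, ← C_mul]
    rw [← Finset.sum_mul, ← map_sum]
    have h2 : ∑ i, g i * coeff (Finsupp.single p 1) (ℓ i) = 0 := this
    rw [h2, map_zero, zero_mul]
  have hsurj : Function.Surjective L.mulVecLin := by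
    rw [← LinearMap.range_eq_top]
    apply Submodule.eq_top_of_finrank_eq
    have := hL.rank_matrix
    rw [Matrix.rank] at this
    rw [this]; simp
  obtain ⟨v, hv⟩ := hsurj (fun i => - coeff 0 (ℓ i))
  have hcard : ∀ j : Fin n, Fintype.card {i : Fin n // i ≠ j} = n - 1 := by
    intro j; simp [Fintype.card_subtype_compl]
  let e : {i : Fin n // i ≠ j0} ≃ Fin (n - 1) := Fintype.equivFinOfCardEq (hcard j0)
  let E : (Fin (n-1) → ({i : Fin n // i ≠ j0} → F)) →ₗ[F] (Fin n × Fin n → F) :=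
    { toFun := fun w p => if h : p.1 ≠ j0 ∧ p.2 ≠ j0 then w (e ⟨p.1, h.1⟩) ⟨p.2, h.2⟩ else 0
      map_add' := by
        intro x y; funext p
        by_cases h : p.1 ≠ j0 ∧ p.2 ≠ j0
        · simp only [dif_pos h, Pi.add_apply]
        · simp only [dif_neg h, Pi.add_apply, add_zero]
      map_smul' := by
        intro x y; funext p
        by_cases h : p.1 ≠ j0 ∧ p.2 ≠ j0
        · simp only [dif_pos h, Pi.smul_apply, RingHom.id_apply]
        · simp only [dif_neg h, Pi.smul_apply, smul_zero] }
  have hE1 : ∀ w (a b : {i : Fin n // i ≠ j0}), E w (a.1, b.1) = w (e a) b := by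
    intro w a b
    exact dif_pos (⟨a.2, b.2⟩ : a.1 ≠ j0 ∧ b.1 ≠ j0)
  have hE0 : ∀ w b, E w (j0, b) = 0 := by
    intro w b
    exact dif_neg (fun h => h.1 rfl)
  obtain ⟨w, hw, hwl⟩ := exists_li (F := F) (n - 1) (V := {i : Fin n // i ≠ j0} → F)
    (by rw [Module.finrank_fintype_fun_eq_card, hcard]) (L.mulVecLin.comp E).ker (by
      have h1 := (L.mulVecLin.comp E).finrank_range_add_finrank_ker
      rw [Module.finrank_pi_fintype, Finset.sum_const, Module.finrank_fintype_fun_eq_card, hcard,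
        Finset.card_univ, Fintype.card_fin, smul_eq_mul] at h1
      have h2 := Submodule.finrank_le (L.mulVecLin.comp E).range
      rw [Module.finrank_fin_fun] at h2
      omega)
  set u := E w with hu
  have hLu : L.mulVec u = 0 := hw
  have hzero : ∀ s : F, ∀ i, eval (s • u + v) (ℓ i) = 0 := by
    intro s i
    rw [hev, Matrix.mulVec_add, Matrix.mulVec_smul, hLu]
    have : L.mulVec v = _ := hv
    rw [this]; simp
  let A : ∀ j : Fin n, Matrix {i : Fin n // i ≠ j} {i : Fin n // i ≠ j} F :=
    fun j => Matrix.of fun a b => u (a.1, b.1)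
  let B : ∀ j : Fin n, Matrix {i : Fin n // i ≠ j} {i : Fin n // i ≠ j} F :=
    fun j => Matrix.of fun a b => v (a.1, b.1)
  let R : Polynomial F := ∑ j ∈ D, Polynomial.C (α j) *
    Matrix.det ((Polynomial.X : Polynomial F) • (A j).map Polynomial.C + (B j).map Polynomial.C)
  have hR : R = 0 := by
    apply Polynomial.funext
    intro s
    have h1 : Ideal.span (Set.range ℓ) ≤ RingHom.ker (eval (s • u + v)) := by
      rw [Ideal.span_le]
      rintro _ ⟨i, rfl⟩
      exact hzero s i
    have h2 : eval (s • u + v) _ = 0 := h1 hmem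
    rw [map_sum] at h2
    rw [Polynomial.eval_zero, ← h2, Polynomial.eval_finsetSum]
    apply Finset.sum_congr rfl
    intro j _
    rw [map_mul, eval_C, Polynomial.eval_mul, Polynomial.eval_C, RingHom.map_det,
      ← Polynomial.coe_evalRingHom, RingHom.map_det]
    congr 2
    ext a b
    simp [A, B]
    ring
  have hc : R.coeff (n - 1) = ∑ j ∈ D, α j * (A j).det := by
    rw [Polynomial.finsetSum_coeff]
    apply Finset.sum_congr rfl
    intro j _
    rw [Polynomial.coeff_C_mul, ← hcard j, Polynomial.coeff_det_X_add_C_card]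
  rw [hR, Polynomial.coeff_zero, Finset.sum_eq_single_of_mem j0 hj0] at hc
  · have hdet : (A j0).det ≠ 0 := by
      rw [← isUnit_iff_ne_zero, ← Matrix.isUnit_iff_isUnit_det, ← Matrix.linearIndependent_rows_iff_isUnit]
      have : (A j0).row = w ∘ e := by
        funext a b
        exact hE1 w a b
      rw [this]
      exact hwl.comp _ e.injective
    exact mul_ne_zero hα0 hdet hc.symm
  · intro j _ hj
    rw [Matrix.det_eq_zero_of_row_eq_zero (⟨j0, hj.symm⟩ : {i : Fin n // i ≠ j}), mul_zero]
    intro b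
    exact hE0 w b.1
end

section
/- Let F be a field, n ≥ 1, and χ : S_n → F^× a group homomorphism from the symmetric group on n elements to the multiplicative group of F. Let M' be an n×n matrix with entries in F[x_{ij} : 1 ≤ i, j ≤ n] that agrees with the matrix of indeterminates (x_{ij}) in all but at most c entries, where c < n (the remaining at most c entries may be arbitrary polynomials). Then the immanant Imm_χ(M') = Σ_{σ ∈ S_n} χ(σ) · ∏_{i=1}^{n} M'_{i,σ(i)} is a nonzero polynomial. -/
open MvPolynomial

theorem comb_aux {n : ℕ} (B : Finset (Fin n × Fin n)) (k : ℕ) :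
    ∀ (R C : Finset (Fin n)), R.card = k → C.card = k →
    (B.filter (fun p => p.1 ∈ R ∧ p.2 ∈ C)).card ≤ k - 1 →
    ∃ π : Fin n → Fin n, Set.InjOn π R ∧ (∀ i ∈ R, π i ∈ C) ∧ (∀ i ∈ R, (i, π i) ∉ B) ∧
      ∀ σ : Fin n → Fin n, Set.InjOn σ R → (∀ i ∈ R, σ i ∈ C) →
        (∀ i ∈ R, (i, σ i) ∈ B ∨ σ i = π i) → ∀ i ∈ R, σ i = π i := by
  induction k with
  | zero =>
    intro R C hR hC _
    rw [Finset.card_eq_zero] at hR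
    subst hR
    exact ⟨id, by simp⟩
  | succ k ih =>
    intro R C hR hC hB
    obtain ⟨r, hr, hrB⟩ : ∃ r ∈ R, ∀ j ∈ C, (r, j) ∉ B := by
      by_contra! h
      have h1 : R ⊆ (B.filter (fun p => p.1 ∈ R ∧ p.2 ∈ C)).image Prod.fst := by
        intro r hr
        obtain ⟨j, hj, hb⟩ := h r hr
        simp only [Finset.mem_image, Finset.mem_filter]
        exact ⟨(r, j), ⟨hb, hr, hj⟩, rfl⟩
      have h2 := Finset.card_le_card h1
      have h3 := h2.trans Finset.card_image_le
      omega
    obtain ⟨j, hj, hjB⟩ : ∃ j ∈ C, (B.filter (fun p => p.1 ∈ R.erase r ∧ p.2 ∈ C.erase j)).card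
        ≤ k - 1 := by
      by_cases he : (B.filter (fun p => p.1 ∈ R ∧ p.2 ∈ C)) = ∅
      · obtain ⟨j, hj⟩ : C.Nonempty := by rw [← Finset.card_pos]; omega
        refine ⟨j, hj, ?_⟩
        have : (B.filter (fun p => p.1 ∈ R.erase r ∧ p.2 ∈ C.erase j)) ⊆
            (B.filter (fun p => p.1 ∈ R ∧ p.2 ∈ C)) := by
          intro p hp
          simp only [Finset.mem_filter, Finset.mem_erase] at hp ⊢
          tauto
        rw [he] at this
        rw [Finset.subset_empty.mp this]
        simp
      · obtain ⟨q, hq⟩ := Finset.nonempty_iff_ne_empty.mpr he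
        have hq' := hq
        simp only [Finset.mem_filter] at hq'
        refine ⟨q.2, hq'.2.2, ?_⟩
        have : (B.filter (fun p => p.1 ∈ R.erase r ∧ p.2 ∈ C.erase q.2)) ⊆
            (B.filter (fun p => p.1 ∈ R ∧ p.2 ∈ C)).erase q := by
          intro p hp
          simp only [Finset.mem_filter, Finset.mem_erase] at hp ⊢
          refine ⟨?_, by tauto⟩
          rintro rfl
          exact hp.2.2.1 rfl
        have h2 := Finset.card_le_card this
        rw [Finset.card_erase_of_mem hq] at h2
        omega
    obtain ⟨π, h1, h2, h3, h4⟩ := ih (R.erase r) (C.erase j)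
      (by rw [Finset.card_erase_of_mem hr]; omega)
      (by rw [Finset.card_erase_of_mem hj]; omega) hjB
    have hne : ∀ i ∈ R, i ≠ r → π i ∈ C ∧ π i ≠ j := fun i hi hir => by
      have := h2 i (Finset.mem_erase.mpr ⟨hir, hi⟩)
      rw [Finset.mem_erase] at this
      exact this.symm
    refine ⟨Function.update π r j, ?_, ?_, ?_, ?_⟩
    · intro a ha b hb hab
      by_cases har : a = r <;> by_cases hbr : b = r
      · rw [har, hbr]
      · subst har
        rw [Function.update_self, Function.update_of_ne hbr] at hab
        exact absurd hab.symm (hne b hb hbr).2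
      · subst hbr
        rw [Function.update_self, Function.update_of_ne har] at hab
        exact absurd hab (hne a ha har).2
      · rw [Function.update_of_ne har, Function.update_of_ne hbr] at hab
        exact h1 (Finset.mem_coe.mpr (Finset.mem_erase.mpr ⟨har, ha⟩))
          (Finset.mem_coe.mpr (Finset.mem_erase.mpr ⟨hbr, hb⟩)) hab
    · intro i hi
      by_cases hir : i = r
      · subst hir; simpa using hj
      · rw [Function.update_of_ne hir]; exact (hne i hi hir).1
    · intro i hi
      by_cases hir : i = r
      · subst hir; simpa using hrB j hj
      · rw [Function.update_of_ne hir]; exact h3 i (Finset.mem_erase.mpr ⟨hir, hi⟩)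
    · intro σ hσ hσC hσB
      have hσr : σ r = j := by
        rcases hσB r hr with h | h
        · exact absurd h (hrB _ (hσC r hr))
        · simpa using h
      have key := h4 σ (hσ.mono (by simp)) (by
        intro i hi
        rw [Finset.mem_erase] at hi ⊢
        refine ⟨fun h => hi.1 (hσ hi.2 hr (h.trans hσr.symm)), hσC i hi.2⟩) (by
        intro i hi
        rw [Finset.mem_erase] at hi
        have := hσB i hi.2
        rwa [Function.update_of_ne hi.1] at this)
      intro i hi
      by_cases hir : i = r
      · subst hir; simpa using hσr
      · rw [Function.update_of_ne hir]; exact key i (Finset.mem_erase.mpr ⟨hir, hi⟩)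

theorem statement10 {F : Type*} [Field F] {n c : ℕ} (hn : 1 ≤ n) (hc : c < n)
    (χ : Equiv.Perm (Fin n) →* Fˣ)
    (M' : Matrix (Fin n) (Fin n) (MvPolynomial (Fin n × Fin n) F))
    (hM' : {p : Fin n × Fin n | M' p.1 p.2 ≠ X p}.ncard ≤ c) :
    ∑ σ : Equiv.Perm (Fin n),
      MvPolynomial.C ((χ σ : Fˣ) : F) * ∏ i : Fin n, M' i (σ i) ≠ 0 := by
  classical
  set S : Set (Fin n × Fin n) := {p : Fin n × Fin n | M' p.1 p.2 ≠ X p} with hS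
  rw [Set.ncard_eq_toFinset_card'] at hM'
  obtain ⟨π, h1, -, h3, h4⟩ := comb_aux S.toFinset n Finset.univ Finset.univ (by simp) (by simp)
    ((Finset.card_filter_le _ _).trans (by omega))
  have hinj : Function.Injective π := fun a b h => h1 (by simp) (by simp) h
  let τ : Equiv.Perm (Fin n) := Equiv.ofBijective π (Finite.injective_iff_bijective.mp hinj)
  have hτ : ∀ i, τ i = π i := fun i => rfl
  intro h0
  have h := congrArg (MvPolynomial.eval (fun p : Fin n × Fin n => if p.2 = π p.1 then (1 : F) else 0)) h0
  have hgood : ∀ i j, (i, j) ∉ S.toFinset → M' i j = X (i, j) := by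
    intro i j hij
    simpa [hS] using hij
  rw [map_sum, Finset.sum_eq_single τ] at h
  · have : ∀ i, M' i (τ i) = X (i, π i) := fun i => hgood i _ (h3 i (by simp))
    simp [this] at h
  · intro σ _ hne
    rw [map_mul, map_prod]
    by_contra hz
    apply hne
    ext1 i
    rw [hτ]
    refine h4 σ σ.injective.injOn (by simp) ?_ i (by simp)
    intro i _
    by_contra! hh
    apply hz
    rw [Finset.prod_eq_zero (Finset.mem_univ i), mul_zero]
    rw [hgood i _ hh.1]
    simp [hh.2]
  · simp
end
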